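/- arXiv:1312.2531 — 3 statements merged into one kernel-verified Lean document; each statement's English description precedes it below -/
import Mathlib

section
/- There is no finite simple bipartite graph whose number of edge covers equals 19, 37, 41, 59, or 67. -/
universe u

open SimpleGraph

/-- The number of edge covers of a finite simple graph: subsets `E'` of the edge set
such that every vertex is incident to at least one edge of `E'`. -/
noncomputable def edgeCoverCount {V : Type*} (G : SimpleGraph V) : ℕ :=
  {E' : Set (Sym2 V) | E' ⊆ G.edgeSet ∧ ∀ v : V, ∃ e ∈ E', v ∈ e}.ncard

namespace ECov

/-- Field width shift `2 ^ 10`. -/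
def ones : ℕ → ℕ
  | 0 => 1
  | m + 1 => ones m + 2 ^ (10 * 2 ^ m) * ones m

def tabs : ℕ → List ℕ
  | 0 => []
  | m + 1 => (2 ^ (10 * 2 ^ m) * ones m) :: (tabs m).map (fun t => t + 2 ^ (10 * 2 ^ m) * t)

/-- Truth table of the block is hit. -/
def orTab : List (ℕ × ℕ) → ℕ
  | [] => 0
  | x :: L => Nat.lor x.2 (orTab L)

/-- Truth table of all blocks with at least two elements are hit. -/
def andTab (T : ℕ) : List (List (ℕ × ℕ)) → ℕ
  | [] => T
  | L :: Ls => match L with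
    | [] => andTab T Ls
    | [_] => andTab T Ls
    | _ :: _ :: _ => Nat.land (orTab L) (andTab T Ls)

def canAdd (cap : ℕ) (x : ℕ × ℕ) (L : List (ℕ × ℕ)) : Bool :=
  Nat.blt L.length cap && L.all (fun y => !(Nat.beq x.1 y.1))

def exts (cap : ℕ) (x : ℕ × ℕ) : List (List (ℕ × ℕ)) → List (List (List (ℕ × ℕ)))
  | [] => [[[x]]]
  | L :: Ls => bif canAdd cap x L then ((x :: L) :: Ls) :: (exts cap x Ls).map (L :: ·)
      else (exts cap x Ls).map (L :: ·)

def okVal (m n : ℕ) : Bool :=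
  Nat.blt 67 n || (Nat.ble m 8 && !(Nat.beq n 19 || Nat.beq n 37 || Nat.beq n 41 || Nat.beq n 59 || Nat.beq n 67))

def dfs (cap m T : ℕ) : List (ℕ × ℕ) → List (List (ℕ × ℕ)) → Bool
  | [], Ls => okVal m ((andTab T Ls) % 1023)
  | x :: l, Ls => (exts cap x Ls).all (fun Ls' => dfs cap m T l Ls')

def chunk : ℕ → List ℕ → List ℕ → List (List (ℕ × ℕ))
  | _, [], _ => []
  | k, s :: ss, ts => ((ts.take s).map (fun t => (k, t))) :: chunk (k + 1) ss (ts.drop s)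

/-- Nondecreasing lists with entries `≥ lo`, `≤ cap`, and sum `n`. -/
def sizes (cap : ℕ) : ℕ → ℕ → ℕ → List (List ℕ)
  | 0, _, n => bif Nat.beq n 0 then [[]] else []
  | fuel + 1, lo, n => bif Nat.beq n 0 then [[]] else
      (List.range (min cap n + 1)).flatMap (fun s => bif Nat.ble lo s then
        (sizes cap fuel s (n - s)).map (s :: ·) else [])

def check (cap m : ℕ) : Bool :=
  (sizes cap m 1 m).all (fun ss =>
    let C := chunk 0 ss (tabs m)
    dfs cap m (andTab (ones m) C) C.flatten [])
end ECov
namespace ECov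

def enc : List Bool → ℕ
  | [] => 0
  | b :: l => b.toNat + 1024 * enc l

theorem enc_append (l l' : List Bool) : enc (l ++ l') = enc l + 2 ^ (10 * l.length) * enc l' := by
  induction l with
  | nil => simp [enc]
  | cons b l ih =>
    simp only [List.cons_append, enc, ih, List.length_cons, Nat.mul_add, pow_add]
    norm_num
    ring

theorem fld_testBit (b : Bool) (x i : ℕ) :
    (b.toNat + 1024 * x).testBit i = if i < 10 then (b.toNat).testBit i else x.testBit (i - 10) := by
  have h : b.toNat < 2 ^ 10 := by cases b <;> simp
  have := Nat.testBit_two_pow_mul_add x h i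
  rw [add_comm]
  exact this

theorem fld_land (b c : Bool) (x y : ℕ) :
    Nat.land (b.toNat + 1024 * x) (c.toNat + 1024 * y)
      = (b && c).toNat + 1024 * (Nat.land x y) := by
  change (b.toNat + 1024 * x) &&& (c.toNat + 1024 * y) = (b && c).toNat + 1024 * (x &&& y)
  apply Nat.eq_of_testBit_eq
  intro i
  rw [Nat.testBit_and, fld_testBit, fld_testBit, fld_testBit]
  split_ifs
  · cases b <;> cases c <;> simp
  · rw [Nat.testBit_and]

theorem fld_lor (b c : Bool) (x y : ℕ) :
    Nat.lor (b.toNat + 1024 * x) (c.toNat + 1024 * y)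
      = (b || c).toNat + 1024 * (Nat.lor x y) := by
  change (b.toNat + 1024 * x) ||| (c.toNat + 1024 * y) = (b || c).toNat + 1024 * (x ||| y)
  apply Nat.eq_of_testBit_eq
  intro i
  rw [Nat.testBit_or, fld_testBit, fld_testBit, fld_testBit]
  split_ifs
  · cases b <;> cases c <;> simp
  · rw [Nat.testBit_or]

def encP {β : Type*} (S : List β) (p : β → Bool) : ℕ := enc (S.map p)

theorem encP_land {β : Type*} (S : List β) (p q : β → Bool) :
    Nat.land (encP S p) (encP S q) = encP S (fun s => p s && q s) := by
  induction S with
  | nil => exact Nat.zero_and 0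
  | cons s S ih =>
    simp only [encP, List.map_cons, enc] at ih ⊢
    rw [fld_land, ih]

theorem encP_lor {β : Type*} (S : List β) (p q : β → Bool) :
    Nat.lor (encP S p) (encP S q) = encP S (fun s => p s || q s) := by
  induction S with
  | nil => exact Nat.zero_or 0
  | cons s S ih =>
    simp only [encP, List.map_cons, enc] at ih ⊢
    rw [fld_lor, ih]

theorem encP_false {β : Type*} (S : List β) : encP S (fun _ => false) = 0 := by
  induction S with
  | nil => rfl
  | cons s S ih =>
    simp only [encP, List.map_cons, enc] at ih ⊢
    rw [ih]; rfl

theorem encP_modEq {β : Type*} (S : List β) (p : β → Bool) :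
    encP S p % 1023 = S.countP p % 1023 := by
  induction S with
  | nil => rfl
  | cons s S ih =>
    simp only [encP, List.map_cons, enc, List.countP_cons] at ih ⊢
    cases p s <;> simp <;> omega

theorem encP_mod {β : Type*} (S : List β) (p : β → Bool) (h : S.length < 1023) :
    encP S p % 1023 = S.countP p := by
  rw [encP_modEq]
  exact Nat.mod_eq_of_lt (lt_of_le_of_lt List.countP_le_length h)

section tables
set_option linter.unusedSectionVars false
variable {ε : Type*} [DecidableEq ε]

theorem ones_eq (l : List ε) : ones l.length = encP l.sublists' (fun _ => true) := by
  induction l with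
  | nil => rfl
  | cons a l ih =>
    rw [List.length_cons, ones, List.sublists'_cons, encP, List.map_append, enc_append]
    simp only [List.map_map, List.length_map, List.length_sublists']
    rw [ih]; rfl

theorem tabs_eq (l : List ε) (h : l.Nodup) :
    tabs l.length = l.map (fun x => encP l.sublists' (fun s => decide (x ∈ s))) := by
  induction l with
  | nil => rfl
  | cons a l ih =>
    have hn := List.nodup_cons.1 h
    rw [List.length_cons, tabs, List.map_cons, ih hn.2]
    congr 1
    · rw [List.sublists'_cons, encP, List.map_append, enc_append]
      have h1 : l.sublists'.map (fun s => decide (a ∈ s)) = l.sublists'.map (fun _ => false) := by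
        apply List.map_congr_left
        intro s hs
        simp only [List.mem_sublists'] at hs
        simpa using fun ha => hn.1 (hs.subset ha)
      have h2 := encP_false l.sublists'
      rw [encP] at h2
      rw [h1, h2, ones_eq l]
      simp only [List.map_map, List.length_map, List.length_sublists', encP]
      have h3 : ((fun s => decide (a ∈ s)) ∘ List.cons a) = (fun _ => true) := by
        funext s; simp
      rw [h3, zero_add]
    · rw [List.map_map]
      apply List.map_congr_left
      intro x hx
      have hxa : x ≠ a := fun e => hn.1 (e ▸ hx)
      rw [List.sublists'_cons]
      simp only [encP, Function.comp, List.map_append, enc_append, List.map_map, List.length_map,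
        List.length_sublists']
      have h3 : ((fun s => decide (x ∈ s)) ∘ List.cons a) = (fun s => decide (x ∈ s)) := by
        funext s; simp [hxa]
      rw [h3]

theorem orTab_eq (S : List (List ε)) (fid : ε → ℕ) (L : List ε) :
    orTab (L.map (fun x => (fid x, encP S (fun s => decide (x ∈ s)))))
      = encP S (fun s => decide (∃ x ∈ L, x ∈ s)) := by
  induction L with
  | nil => simp [orTab, encP_false]
  | cons x L ih =>
    rw [List.map_cons, orTab, ih, encP_lor]
    congr 1
    funext s
    simp

theorem andTab_eq (S : List (List ε)) (fid : ε → ℕ) (p : List ε → Prop) [DecidablePred p]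
    (Ls : List (List ε)) :
    andTab (encP S (fun s => decide (p s)))
      (Ls.map (List.map (fun x => (fid x, encP S (fun s => decide (x ∈ s))))))
      = encP S (fun s => decide (p s ∧ ∀ L ∈ Ls, 2 ≤ L.length → ∃ x ∈ L, x ∈ s)) := by
  induction Ls with
  | nil => simp [andTab]
  | cons L Ls ih =>
    match L with
    | [] => 
      simp only [List.map_cons, List.map_nil, andTab, ih]
      congr 1; funext s; simp
    | [y] => 
      simp only [List.map_cons, List.map_nil, andTab, ih]
      congr 1; funext s; simp
    | y :: z :: L =>
      have h := orTab_eq S fid (y :: z :: L)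
      simp only [List.map_cons, andTab] at h ⊢
      rw [ih, h, encP_land]
      congr 1; funext s
      rw [← Bool.decide_and]
      congr 1
      simp only [List.forall_mem_cons (a := y :: z :: L), List.length_cons, eq_iff_iff]
      constructor
      · rintro ⟨h1, h2, h3⟩; exact ⟨h2, fun _ => h1, h3⟩
      · rintro ⟨h2, h1, h3⟩; exact ⟨h1 (by omega), h2, h3⟩

end tables

section search
set_option linter.unusedSectionVars false
variable {ε : Type*} [DecidableEq ε] {κ : Type*}

def Cls (g : ε → κ) (Ls : List (List ε)) : Prop :=
  (∀ L ∈ Ls, L ≠ [] ∧ ∀ x ∈ L, ∀ y ∈ L, g x = g y) ∧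
    Ls.Pairwise (fun L L' => ∀ x ∈ L, ∀ y ∈ L', g x ≠ g y)

theorem exts_sound (g : ε → κ) (φ : ε → ℕ × ℕ) (cap : ℕ) (x : ε) (Ls : List (List ε))
    (hc : Cls g Ls)
    (hadd : ∀ L ∈ Ls, (∀ y ∈ L, g y = g x) → canAdd cap (φ x) (L.map φ) = true) :
    ∃ Ls', Cls g Ls' ∧ Ls'.flatten.Perm (x :: Ls.flatten) ∧
      Ls'.map (List.map φ) ∈ exts cap (φ x) (Ls.map (List.map φ)) := by
  induction Ls with
  | nil => exact ⟨[[x]], ⟨by simp, by simp⟩, by simp, by simp [exts]⟩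
  | cons L Ls ih =>
    obtain ⟨h1, h2⟩ := hc
    rw [List.pairwise_cons] at h2
    by_cases hx : ∀ y ∈ L, g y = g x
    · refine ⟨(x :: L) :: Ls, ⟨?_, ?_⟩, by simp, ?_⟩
      · intro M hM
        rcases List.mem_cons.1 hM with rfl | hM
        · refine ⟨by simp, ?_⟩
          have : ∀ z ∈ x :: L, g z = g x := by
            intro z hz
            rcases List.mem_cons.1 hz with rfl | hz
            · rfl
            · exact hx z hz
          intro a ha b hb
          rw [this a ha, this b hb]
        · exact h1 M (List.mem_cons_of_mem _ hM)
      · rw [List.pairwise_cons]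
        refine ⟨?_, h2.2⟩
        intro M hM a ha b hb
        rcases List.mem_cons.1 ha with rfl | ha
        · obtain ⟨z, hz⟩ := List.exists_mem_of_ne_nil L (h1 L (by simp)).1
          rw [← hx z hz]
          exact h2.1 M hM z hz b hb
        · exact h2.1 M hM a ha b hb
      · have := hadd L (by simp) hx
        simp [exts, this]
    · obtain ⟨Ls', hc', hp, hm⟩ := ih ⟨fun M hM => h1 M (List.mem_cons_of_mem _ hM), h2.2⟩
        (fun M hM => hadd M (List.mem_cons_of_mem _ hM))
      refine ⟨L :: Ls', ⟨?_, ?_⟩, ?_, ?_⟩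
      · intro M hM
        rcases List.mem_cons.1 hM with rfl | hM
        · exact h1 _ (by simp)
        · exact hc'.1 M hM
      · rw [List.pairwise_cons]
        refine ⟨?_, hc'.2⟩
        intro M hM a ha b hb
        have hb' : b ∈ x :: Ls.flatten := hp.mem_iff.1 (List.mem_flatten.2 ⟨M, hM, hb⟩)
        rcases List.mem_cons.1 hb' with rfl | hb'
        · intro hab
          apply hx
          intro y hy
          rw [← hab]
          exact (h1 L (by simp)).2 y hy a ha
        · obtain ⟨M', hM', hb''⟩ := List.mem_flatten.1 hb'
          exact h2.1 M' hM' a ha b hb''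
      · simp only [List.flatten_cons]
        exact (List.Perm.append_left L hp).trans List.perm_middle
      · rw [List.map_cons, exts]
        have : L.map φ :: Ls'.map (List.map φ) ∈
            (exts cap (φ x) (Ls.map (List.map φ))).map (L.map φ :: ·) := List.mem_map_of_mem hm
        cases canAdd cap (φ x) (L.map φ)
        · simpa using this
        · simp only [cond_true]
          exact List.mem_cons_of_mem _ this

theorem dfs_sound (g : ε → κ) (φ : ε → ℕ × ℕ) (cap m T : ℕ) (E : Finset ε)
    (hcap : ∀ L : List ε, L.Nodup → (∀ x ∈ L, x ∈ E) → (∀ x ∈ L, ∀ y ∈ L, g x = g y) →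
      L.length ≤ cap)
    (hs : ∀ x ∈ E, ∀ y ∈ E, (φ x).1 = (φ y).1 → g x = g y → x = y)
    (l : List ε) : ∀ (Ls : List (List ε)), Cls g Ls → (l ++ Ls.flatten).Nodup →
      (∀ x ∈ l ++ Ls.flatten, x ∈ E) → dfs cap m T (l.map φ) (Ls.map (List.map φ)) = true →
      ∃ Ls', Cls g Ls' ∧ Ls'.flatten.Perm (l ++ Ls.flatten) ∧
        okVal m ((andTab T (Ls'.map (List.map φ))) % 1023) = true := by
  induction l with
  | nil =>
    intro Ls hc _ _ hd
    exact ⟨Ls, hc, by simp, by simpa [dfs] using hd⟩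
  | cons x l ih =>
    intro Ls hc hn hE hd
    obtain ⟨Ls1, hc1, hp1, hm1⟩ := exts_sound g φ cap x Ls hc (by
      intro L hL hLx
      have hsub : L.Sublist Ls.flatten := List.sublist_flatten_of_mem hL
      have hnx : (x :: L).Nodup := by
        refine hn.sublist ?_
        rw [List.cons_append]
        exact (hsub.trans (List.sublist_append_right _ _)).cons_cons x
      have hEx : ∀ y ∈ x :: L, y ∈ E := by
        intro y hy
        apply hE
        rcases List.mem_cons.1 hy with rfl | hy
        · simp
        · exact List.mem_append_right _ (hsub.subset hy)
      have hgx : ∀ y ∈ x :: L, g y = g x := by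
        intro y hy
        rcases List.mem_cons.1 hy with rfl | hy
        · rfl
        · exact hLx y hy
      have h1 := hcap (x :: L) hnx hEx (fun a ha b hb => (hgx a ha).trans (hgx b hb).symm)
      rw [canAdd, Bool.and_eq_true]
      constructor
      · rw [Nat.blt_eq]; simpa using h1
      · simp only [List.all_map, List.all_eq_true, Function.comp]
        intro y hy
        have hxy : ¬ (φ x).1 = (φ y).1 := by
          intro he
          have := hs x (hEx x (by simp)) y (hEx y (by simp [hy])) he (hLx y hy).symm
          subst this
          exact (List.nodup_cons.1 hnx).1 hy
        rw [Bool.not_eq_true']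
        rw [← Bool.not_eq_true, Nat.beq_eq]
        exact hxy)
    have hperm : (l ++ Ls1.flatten).Perm (x :: l ++ Ls.flatten) :=
      (List.Perm.append_left l hp1).trans List.perm_middle
    have hd1 : dfs cap m T (l.map φ) (Ls1.map (List.map φ)) = true := by
      rw [List.map_cons, dfs, List.all_eq_true] at hd
      exact hd _ hm1
    obtain ⟨Ls2, hc2, hp2, hv⟩ := ih Ls1 hc1 (hperm.nodup_iff.2 hn)
      (fun y hy => hE y (hperm.mem_iff.1 hy)) hd1
    exact ⟨Ls2, hc2, hp2.trans hperm, hv⟩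

theorem exists_cls (g : ε → κ) (l : List ε) (hl : l.Nodup) :
    ∃ Ls, Cls g Ls ∧ Ls.flatten.Perm l := by
  induction l with
  | nil => exact ⟨[], ⟨by simp, by simp⟩, by simp⟩
  | cons x l ih =>
    rw [List.nodup_cons] at hl
    obtain ⟨Ls, hc, hp⟩ := ih hl.2
    obtain ⟨Ls', hc', hp', -⟩ := exts_sound g (fun y => if y = x then (1, 0) else (0, 0))
      (Ls.flatten.length + 1) x Ls hc (by
        intro L hL _
        have hsub : L.Sublist Ls.flatten := List.sublist_flatten_of_mem hL
        rw [canAdd, Bool.and_eq_true]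
        constructor
        · rw [Nat.blt_eq, List.length_map]
          exact Nat.lt_succ_of_le hsub.length_le
        · simp only [List.all_map, List.all_eq_true, Function.comp]
          intro y hy
          have : y ≠ x := by
            rintro rfl
            exact hl.1 (hp.mem_iff.1 (hsub.subset hy))
          simp only [this, if_true, if_false]; rfl)
    exact ⟨Ls', hc', hp'.trans (hp.cons x)⟩

theorem exists_cls_sorted (g : ε → κ) (l : List ε) (hl : l.Nodup) :
    ∃ Ls, Cls g Ls ∧ Ls.flatten.Perm l ∧ (Ls.map List.length).Pairwise (· ≤ ·) := by
  obtain ⟨Ls, hc, hp⟩ := exists_cls g l hl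
  let r : List ε → List ε → Prop := fun a b => a.length ≤ b.length
  have hpm : (Ls.insertionSort r).Perm Ls := List.perm_insertionSort r Ls
  have : Std.Total r := ⟨fun a b => Nat.le_total _ _⟩
  have : IsTrans (List ε) r := ⟨fun a b c h1 h2 => Nat.le_trans h1 h2⟩
  refine ⟨Ls.insertionSort r, ⟨fun L hL => hc.1 L (hpm.mem_iff.1 hL), ?_⟩, hpm.flatten.trans hp, ?_⟩
  · refine (hpm.pairwise_iff ?_).2 hc.2
    intro a b h x hx y hy he
    exact h y hy x hx he.symm
  · rw [List.pairwise_map]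
    exact List.pairwise_insertionSort r Ls

theorem sizes_mem (cap : ℕ) (ss : List ℕ) : ∀ (fuel lo n : ℕ), ss.Pairwise (· ≤ ·) →
    (∀ s ∈ ss, lo ≤ s ∧ 1 ≤ s ∧ s ≤ cap) → ss.sum = n → n ≤ fuel → ss ∈ sizes cap fuel lo n := by
  induction ss with
  | nil =>
    intro fuel lo n _ _ hn _
    simp only [List.sum_nil] at hn
    subst hn
    cases fuel <;> simp [sizes]
  | cons s ss ih =>
    intro fuel lo n hp hb hn hf
    rw [List.pairwise_cons] at hp
    obtain ⟨h1, h2, h3⟩ := hb s (by simp)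
    rw [List.sum_cons] at hn
    cases fuel with
    | zero => omega
    | succ fuel =>
      have hn0 : Nat.beq n 0 = false := by
        rw [← Bool.not_eq_true, Nat.beq_eq]; omega
      rw [sizes, hn0, cond_false, List.mem_flatMap]
      refine ⟨s, ?_, ?_⟩
      · rw [List.mem_range]; omega
      · have : Nat.ble lo s = true := by rw [Nat.ble_eq]; exact h1
        rw [this, cond_true]
        apply List.mem_map_of_mem
        apply ih fuel s (n - s) hp.2 _ (by omega) (by omega)
        intro t ht
        have := hb t (by simp [ht])
        exact ⟨hp.1 t ht, this.2⟩

theorem chunk_eq (f : ε → κ) (tab : ε → ℕ) (Ls : List (List ε)) : ∀ (k : ℕ), Cls f Ls →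
    ∃ fid : ε → ℕ, Ls.map (List.map (fun x => (fid x, tab x)))
        = chunk k (Ls.map List.length) (Ls.flatten.map tab) ∧
      (∀ x ∈ Ls.flatten, k ≤ fid x) ∧
      ∀ x ∈ Ls.flatten, ∀ y ∈ Ls.flatten, fid x = fid y → f x = f y := by
  induction Ls with
  | nil => intro k _; exact ⟨fun _ => 0, by simp [chunk], by simp, by simp⟩
  | cons L Ls ih =>
    intro k hc
    obtain ⟨h1, h2⟩ := hc
    rw [List.pairwise_cons] at h2
    obtain ⟨fid, e1, e2, e3⟩ := ih (k + 1) ⟨fun M hM => h1 M (List.mem_cons_of_mem _ hM), h2.2⟩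
    have hnot : ∀ M ∈ Ls, ∀ x ∈ M, x ∉ L := fun M hM x hx hxL => h2.1 M hM x hxL x hx rfl
    refine ⟨fun x => if x ∈ L then k else fid x, ?_, ?_, ?_⟩
    · rw [List.map_cons, List.map_cons, chunk, List.flatten_cons, List.map_append]
      rw [List.take_left' (by simp), List.drop_left' (by simp), ← e1]
      congr 1
      · rw [List.map_map]
        apply List.map_congr_left
        intro x hx
        simp [hx]
      · apply List.map_congr_left
        intro M hM
        apply List.map_congr_left
        intro x hx
        simp [hnot M hM x hx]
    · intro x hx
      rw [List.flatten_cons, List.mem_append] at hx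
      by_cases hL : x ∈ L
      · simp [hL]
      · have := e2 x (hx.resolve_left hL)
        simp only [hL, if_false]; omega
    · intro x hx y hy
      rw [List.flatten_cons, List.mem_append] at hx hy
      by_cases hxL : x ∈ L <;> by_cases hyL : y ∈ L
      · intro _; exact (h1 L (by simp)).2 x hxL y hyL
      · have := e2 y (hy.resolve_left hyL)
        simp only [hxL, hyL, if_true, if_false]; omega
      · have := e2 x (hx.resolve_left hxL)
        simp only [hxL, hyL, if_true, if_false]; omega
      · simp only [hxL, hyL, if_false]
        exact e3 x (hx.resolve_left hxL) y (hy.resolve_left hyL)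

/-- `F` hits every class of `g` on `E` with at least two elements. -/
def Hit (E : Finset ε) (g : ε → κ) (F : Finset ε) : Prop :=
  ∀ x ∈ E, ∀ y ∈ E, x ≠ y → g x = g y → ∃ z ∈ E, g z = g x ∧ z ∈ F

theorem hit_iff (E : Finset ε) (g : ε → κ) (Ls : List (List ε)) (hc : Cls g Ls)
    (hE : ∀ x, x ∈ Ls.flatten ↔ x ∈ E) (hn : Ls.flatten.Nodup) (F : Finset ε) :
    Hit E g F ↔ ∀ L ∈ Ls, 2 ≤ L.length → ∃ x ∈ L, x ∈ F := by
  have same : ∀ L ∈ Ls, ∀ x ∈ L, ∀ y ∈ E, g y = g x → y ∈ L := by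
    intro L hL x hx y hy he
    obtain ⟨M, hM, hyM⟩ := List.mem_flatten.1 ((hE y).2 hy)
    by_cases hLM : L = M
    · rw [hLM]; exact hyM
    · exfalso
      have : Std.Symm (fun L L' : List ε => ∀ x ∈ L, ∀ y ∈ L', g x ≠ g y) :=
        ⟨fun a b h x hx y hy he => h y hy x hx he.symm⟩
      exact hc.2.forall hL hM hLM x hx y hyM he.symm
  constructor
  · intro h L hL h2
    have hnL : L.Nodup := hn.sublist (List.sublist_flatten_of_mem hL)
    have hLE : ∀ z ∈ L, z ∈ E := fun z hz => (hE z).1 (List.mem_flatten.2 ⟨L, hL, hz⟩)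
    match L, h2 with
    | x :: y :: M, _ =>
      have hxy : x ≠ y := by
        rintro rfl
        simp at hnL
      obtain ⟨z, hz, he, hzF⟩ := h x (hLE x (by simp)) y (hLE y (by simp)) hxy
        ((hc.1 _ hL).2 x (by simp) y (by simp))
      exact ⟨z, same _ hL x (by simp) z hz he, hzF⟩
  · intro h x hx y hy hxy he
    obtain ⟨L, hL, hxL⟩ := List.mem_flatten.1 ((hE x).2 hx)
    have hyL := same L hL x hxL y hy he.symm
    have h2 : 2 ≤ L.length := by
      have hsub : ({x, y} : Finset ε) ⊆ L.toFinset := by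
        intro z hz
        simp only [Finset.mem_insert, Finset.mem_singleton] at hz
        rcases hz with rfl | rfl <;> simpa
      have := Finset.card_le_card hsub
      rw [Finset.card_pair hxy] at this
      exact this.trans (List.toFinset_card_le L)
    obtain ⟨z, hz, hzF⟩ := h L hL h2
    exact ⟨z, (hE z).1 (List.mem_flatten.2 ⟨L, hL, hz⟩), (hc.1 L hL).2 z hz x hxL, hzF⟩

open Classical in
theorem main_check (cap m : ℕ) (hm : m ≤ 9) (hchk : check cap m = true) (E : Finset ε)
    (hcard : E.card = m) (f g : ε → κ)
    (hcapf : ∀ L : List ε, L.Nodup → (∀ x ∈ L, x ∈ E) → (∀ x ∈ L, ∀ y ∈ L, f x = f y) →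
      L.length ≤ cap)
    (hcapg : ∀ L : List ε, L.Nodup → (∀ x ∈ L, x ∈ E) → (∀ x ∈ L, ∀ y ∈ L, g x = g y) →
      L.length ≤ cap)
    (hs : ∀ x ∈ E, ∀ y ∈ E, f x = f y → g x = g y → x = y) :
    okVal m (E.powerset.filter (fun F => Hit E f F ∧ Hit E g F)).card = true := by
  obtain ⟨LA, hcA, hpA, hsA⟩ := exists_cls_sorted f E.toList E.nodup_toList
  set l := LA.flatten with hl
  have hln : l.Nodup := hpA.nodup_iff.2 E.nodup_toList
  have hlE : ∀ x, x ∈ l ↔ x ∈ E := fun x => by rw [hpA.mem_iff, Finset.mem_toList]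
  have hlen : l.length = m := by rw [hpA.length_eq, Finset.length_toList, hcard]
  have hmem : LA.map List.length ∈ sizes cap m 1 m := by
    apply sizes_mem cap _ m 1 m hsA _ _ le_rfl
    · intro s hs
      obtain ⟨L, hL, rfl⟩ := List.mem_map.1 hs
      have h1 : 1 ≤ L.length := List.length_pos_iff.2 (hcA.1 L hL).1
      refine ⟨h1, h1, ?_⟩
      exact hcapf L (hln.sublist (List.sublist_flatten_of_mem hL))
        (fun z hz => (hlE z).1 (List.mem_flatten.2 ⟨L, hL, hz⟩)) (hcA.1 L hL).2
    · rw [← hlen, hl, List.length_flatten]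
  let tab : ε → ℕ := fun x => encP l.sublists' (fun s => decide (x ∈ s))
  obtain ⟨fid, e1, -, e3⟩ := chunk_eq f tab LA 0 hcA
  have htabs : tabs m = l.map tab := by rw [← hlen]; exact tabs_eq l hln
  rw [check, List.all_eq_true] at hchk
  have hd := hchk _ hmem
  simp only at hd
  rw [htabs, ← e1] at hd
  have hflat : (LA.map (List.map (fun x => (fid x, tab x)))).flatten
      = l.map (fun x => (fid x, tab x)) := by
    rw [hl, List.map_flatten]
  rw [hflat] at hd
  obtain ⟨LB, hcB, hpB, hv⟩ := dfs_sound g (fun x => (fid x, tab x)) cap m _ E hcapg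
    (fun x hx y hy he => hs x hx y hy (e3 x ((hlE x).2 hx) y ((hlE y).2 hy) he)) l []
    ⟨by simp, by simp⟩ (by simpa using hln) (by simpa using fun x hx => (hlE x).1 hx)
    (by simpa using hd)
  simp only [List.flatten_nil, List.append_nil] at hpB
  have hones : ones m = encP l.sublists' (fun _ => decide True) := by
    rw [← hlen, ones_eq]; simp
  rw [hones] at hv
  have hA := andTab_eq l.sublists' fid (fun _ => True) LA
  have hB := andTab_eq l.sublists' fid
    (fun s => True ∧ ∀ L ∈ LA, 2 ≤ L.length → ∃ x ∈ L, x ∈ s) LB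
  rw [hA, hB, encP_mod] at hv
  · convert hv using 2
    have hcount : (E.powerset.filter (fun F => Hit E f F ∧ Hit E g F)).card
        = Multiset.countP (fun F : Multiset ε => Hit E f F.toFinset ∧ Hit E g F.toFinset)
          (Multiset.powerset E.val) := by
      have hv : E.powerset.val.map Finset.val = E.val.powerset := by
        simp [Finset.powerset, Multiset.map_pmap, Multiset.pmap_eq_map]
      rw [← hv, Multiset.countP_map, Finset.card_def, Finset.filter_val]
      congr 1
      apply Multiset.filter_congr
      intro F _
      simp
    rw [hcount]
    have hEv : E.val = (l : Multiset ε) := by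
      rw [← Finset.coe_toList]
      exact (Multiset.coe_eq_coe.2 hpA).symm
    rw [hEv, Multiset.powerset_coe', Multiset.coe_countP, List.countP_map]
    apply List.countP_congr
    intro s _
    have hlB : ∀ x, x ∈ LB.flatten ↔ x ∈ E := fun x => by rw [hpB.mem_iff]; exact hlE x
    simp only [Function.comp, decide_eq_true_eq]
    rw [hit_iff E f LA hcA hlE hln, hit_iff E g LB hcB hlB (hpB.nodup_iff.2 hln)]
    simp
  · rw [List.length_sublists', hlen]
    calc 2 ^ m ≤ 2 ^ 9 := Nat.pow_le_pow_right (by norm_num) hm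
      _ < 1023 := by norm_num

end search
end ECov
namespace ECov
section families
variable {ε : Type*}

/-- Constraint families as arising from one side of a bipartite graph. -/
def Good (E : Finset ε) (A : Finset (Finset ε)) : Prop :=
  (∀ a ∈ A, a ⊆ E) ∧ ∀ a ∈ A, ∀ a' ∈ A, ∀ x ∈ a, x ∈ a' → a = a'

def Simp (A B : Finset (Finset ε)) : Prop :=
  ∀ a ∈ A, ∀ b ∈ B, ∀ x ∈ a, ∀ y ∈ a, x ∈ b → y ∈ b → x = y

def Hits (A : Finset (Finset ε)) (F : Finset ε) : Prop := ∀ a ∈ A, ∃ x ∈ a, x ∈ F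

open Classical in
noncomputable def cnt (E : Finset ε) (A B : Finset (Finset ε)) : ℕ :=
  (E.powerset.filter (fun F => Hits A F ∧ Hits B F)).card

open Classical in
noncomputable def lab (A : Finset (Finset ε)) (x : ε) : Finset ε :=
  if h : ∃ a ∈ A, x ∈ a then h.choose else {x}

theorem lab_eq {E : Finset ε} {A : Finset (Finset ε)} (hA : Good E A) {a : Finset ε} (ha : a ∈ A)
    {x : ε} (hx : x ∈ a) : lab A x = a := by
  have h : ∃ a ∈ A, x ∈ a := ⟨a, ha, hx⟩
  rw [lab, dif_pos h]
  exact hA.2 _ h.choose_spec.1 _ ha x h.choose_spec.2 hx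

theorem lab_self (A : Finset (Finset ε)) (x : ε) : x ∈ lab A x := by
  unfold lab
  split_ifs with h
  · exact h.choose_spec.2
  · simp

theorem lab_mem {A : Finset (Finset ε)} {x y : ε} (hxy : x ≠ y) (h : lab A x = lab A y) :
    lab A x ∈ A := by
  have hy : y ∈ lab A x := h ▸ lab_self A y
  unfold lab at hy ⊢
  split_ifs at hy ⊢ with h
  · exact h.choose_spec.1
  · exact absurd (Finset.mem_singleton.1 hy).symm hxy

theorem hit_lab_iff {E : Finset ε} {A : Finset (Finset ε)} (hA : Good E A)
    (h2 : ∀ a ∈ A, 2 ≤ a.card) (F : Finset ε) : Hit E (lab A) F ↔ Hits A F := by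
  constructor
  · intro h a ha
    obtain ⟨x, hx, y, hy, hxy⟩ := Finset.one_lt_card.1 (h2 a ha)
    obtain ⟨z, hz, he, hzF⟩ := h x (hA.1 a ha hx) y (hA.1 a ha hy) hxy
      (by rw [lab_eq hA ha hx, lab_eq hA ha hy])
    refine ⟨z, ?_, hzF⟩
    rw [← lab_eq hA ha hx, ← he]
    exact lab_self A z
  · intro h x hx y hy hxy he
    have hm := lab_mem hxy he
    obtain ⟨z, hz, hzF⟩ := h _ hm
    exact ⟨z, hA.1 _ hm hz, lab_eq hA hm hz, hzF⟩

theorem lab_cap (cap : ℕ) (A : Finset (Finset ε)) (E : Finset ε) (hcap : ∀ x ∈ E, (lab A x).card ≤ cap)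
    (L : List ε) (hn : L.Nodup) (hE : ∀ x ∈ L, x ∈ E)
    (hc : ∀ x ∈ L, ∀ y ∈ L, lab A x = lab A y) : L.length ≤ cap := by
  classical
  cases L with
  | nil => simp
  | cons x L =>
    rw [← List.toFinset_card_of_nodup hn]
    refine le_trans (Finset.card_le_card ?_) (hcap x (hE x (by simp)))
    intro y hy
    rw [List.mem_toFinset] at hy
    rw [hc x (by simp) y hy]
    exact lab_self A y

theorem family_check (cap m : ℕ) (hm : m ≤ 9) (hchk : check cap m = true) (E : Finset ε)
    (hcard : E.card = m) (A B : Finset (Finset ε)) (hA : Good E A) (hB : Good E B)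
    (hs : Simp A B) (hA2 : ∀ a ∈ A, 2 ≤ a.card) (hB2 : ∀ a ∈ B, 2 ≤ a.card)
    (hcA : ∀ a ∈ A, a.card ≤ cap) (hcB : ∀ a ∈ B, a.card ≤ cap) (h1 : 0 < m → 0 < cap) :
    okVal m (cnt E A B) = true := by
  classical
  have hlc : ∀ A : Finset (Finset ε), (∀ a ∈ A, a.card ≤ cap) → ∀ x ∈ E, (lab A x).card ≤ cap := by
    intro A hA x hx
    unfold lab
    split_ifs with h
    · exact hA _ h.choose_spec.1
    · rw [Finset.card_singleton]
      apply h1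
      rw [← hcard]
      exact Finset.card_pos.2 ⟨x, hx⟩
  have := main_check cap m hm hchk E hcard (lab A) (lab B) (lab_cap cap A E (hlc A hcA))
    (lab_cap cap B E (hlc B hcB)) (by
      intro x hx y hy hf hg
      by_contra hxy
      apply hxy
      exact hs _ (lab_mem hxy hf) _ (lab_mem hxy hg) x (lab_self A x) y (hf ▸ lab_self A y)
        (lab_self B x) (hg ▸ lab_self B y))
  unfold cnt
  simp only [hit_lab_iff hA hA2, hit_lab_iff hB hB2] at this
  convert this using 4

def bad (n : ℕ) : Prop := n = 19 ∨ n = 37 ∨ n = 41 ∨ n = 59 ∨ n = 67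

theorem check_small (m : ℕ) (hm : m ≤ 8) : check m m = true := by
  interval_cases m <;> decide +kernel

theorem check_nine : check 2 9 = true := by
  decide +kernel

theorem cnt_unit {E : Finset ε} {A B : Finset (Finset ε)} {e : ε} (hA : Good E A)
    (hB : Good E B) (h : {e} ∈ A ∨ {e} ∈ B) :
    ∃ (E' : Finset ε) (A' B' : Finset (Finset ε)), E'.card < E.card ∧ Good E' A' ∧ Good E' B' ∧ (Simp A B → Simp A' B') ∧
      cnt E A B = cnt E' A' B' := by
  classical
  have he : e ∈ E := by
    rcases h with h | h
    · exact hA.1 _ h (by simp)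
    · exact hB.1 _ h (by simp)
  have hg : ∀ A, Good E A → Good (E.erase e) (A.filter (e ∉ ·)) := by
    intro A hA
    refine ⟨?_, ?_⟩
    · intro a ha x hx
      rw [Finset.mem_filter] at ha
      rw [Finset.mem_erase]
      exact ⟨fun hxe => ha.2 (hxe ▸ hx), hA.1 a ha.1 hx⟩
    · intro a ha a' ha'
      exact hA.2 a (Finset.mem_filter.1 ha).1 a' (Finset.mem_filter.1 ha').1
  have key : ∀ (A : Finset (Finset ε)) (F : Finset ε), e ∈ F →
      (Hits A F ↔ Hits (A.filter (e ∉ ·)) (F.erase e)) := by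
    intro A F heF
    constructor
    · intro h a ha
      rw [Finset.mem_filter] at ha
      obtain ⟨x, hx, hxF⟩ := h a ha.1
      exact ⟨x, hx, Finset.mem_erase.2 ⟨fun hxe => ha.2 (hxe ▸ hx), hxF⟩⟩
    · intro h a ha
      by_cases hea : e ∈ a
      · exact ⟨e, hea, heF⟩
      · obtain ⟨x, hx, hxF⟩ := h a (Finset.mem_filter.2 ⟨ha, hea⟩)
        exact ⟨x, hx, Finset.mem_of_mem_erase hxF⟩
  have hforce : ∀ F, Hits A F ∧ Hits B F → e ∈ F := by
    rintro F ⟨h1, h2⟩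
    rcases h with h | h
    · obtain ⟨x, hx, hxF⟩ := h1 _ h
      rwa [← Finset.mem_singleton.1 hx]
    · obtain ⟨x, hx, hxF⟩ := h2 _ h
      rwa [← Finset.mem_singleton.1 hx]
  refine ⟨E.erase e, A.filter (e ∉ ·), B.filter (e ∉ ·), Finset.card_erase_lt_of_mem he,
    hg A hA, hg B hB, ?_, ?_⟩
  · intro hs a ha b hb
    exact hs a (Finset.mem_filter.1 ha).1 b (Finset.mem_filter.1 hb).1
  · unfold cnt
    refine Finset.card_bij' (fun F _ => F.erase e) (fun F _ => insert e F) ?_ ?_ ?_ ?_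
    · intro F hF
      rw [Finset.mem_filter, Finset.mem_powerset] at hF ⊢
      have heF := hforce F hF.2
      exact ⟨Finset.erase_subset_erase e hF.1, (key A F heF).1 hF.2.1, (key B F heF).1 hF.2.2⟩
    · intro F hF
      rw [Finset.mem_filter, Finset.mem_powerset] at hF ⊢
      have heF : e ∉ F := fun h => by simpa using hF.1 h
      rw [key A _ (Finset.mem_insert_self e F), key B _ (Finset.mem_insert_self e F),
        Finset.erase_insert heF]
      refine ⟨?_, hF.2⟩
      intro x hx
      rcases Finset.mem_insert.1 hx with rfl | hx
      · exact he
      · exact Finset.mem_of_mem_erase (hF.1 hx)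
    · intro F hF
      rw [Finset.mem_filter] at hF
      exact Finset.insert_erase (hforce F hF.2)
    · intro F hF
      rw [Finset.mem_filter, Finset.mem_powerset] at hF
      exact Finset.erase_insert (fun h => by simpa using hF.1 h)

theorem cnt_big {E : Finset ε} {A B : Finset (Finset ε)} (hA : Good E A)
    (hB : Good E B) (hs : Simp A B) (hA2 : ∀ a ∈ A, 2 ≤ a.card) (hB2 : ∀ a ∈ B, 2 ≤ a.card)
    (h9 : 9 ≤ E.card) : 67 < cnt E A B := by
  classical
  obtain ⟨E9, hsub, hcard⟩ := Finset.exists_subset_card_eq h9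
  have hτ : ∀ c : Finset ε, ∃ d ⊆ c, 2 ≤ c.card → d.card = 2 := by
    intro c
    by_cases h : 2 ≤ c.card
    · obtain ⟨d, hd, hd2⟩ := Finset.exists_subset_card_eq h
      exact ⟨d, hd, fun _ => hd2⟩
    · exact ⟨∅, by simp, fun h' => absurd h' h⟩
  choose τ hτs hτ2 using hτ
  let R : Finset (Finset ε) → Finset (Finset ε) := fun A => (A.filter (· ⊆ E9)).image τ
  have hR : ∀ A a', a' ∈ R A → ∃ a ∈ A, a ⊆ E9 ∧ τ a = a' := by
    intro A a' ha'
    obtain ⟨a, ha, rfl⟩ := Finset.mem_image.1 ha'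
    rw [Finset.mem_filter] at ha
    exact ⟨a, ha.1, ha.2, rfl⟩
  have hg : ∀ A, Good E A → Good E9 (R A) := by
    intro A hA
    refine ⟨?_, ?_⟩
    · intro a' ha'
      obtain ⟨a, ha, haE, rfl⟩ := hR A a' ha'
      exact (hτs a).trans haE
    · intro a' ha' b' hb' x hx hx'
      obtain ⟨a, ha, haE, rfl⟩ := hR A a' ha'
      obtain ⟨b, hb, hbE, rfl⟩ := hR A b' hb'
      rw [hA.2 a ha b hb x (hτs a hx) (hτs b hx')]
  have hc2 : ∀ A : Finset (Finset ε), (∀ a ∈ A, 2 ≤ a.card) → ∀ a ∈ R A, a.card = 2 := by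
    intro A hA a' ha'
    obtain ⟨a, ha, haE, rfl⟩ := hR A a' ha'
    exact hτ2 a (hA a ha)
  have hs' : Simp (R A) (R B) := by
    intro a' ha' b' hb' x hx y hy hx' hy'
    obtain ⟨a, ha, haE, rfl⟩ := hR A a' ha'
    obtain ⟨b, hb, hbE, rfl⟩ := hR B b' hb'
    exact hs a ha b hb x (hτs a hx) y (hτs a hy) (hτs b hx') (hτs b hy')
  have hv := family_check 2 9 le_rfl check_nine E9 hcard (R A) (R B) (hg A hA) (hg B hB) hs'
    (fun a ha => (hc2 A hA2 a ha).ge) (fun a ha => (hc2 B hB2 a ha).ge)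
    (fun a ha => (hc2 A hA2 a ha).le) (fun a ha => (hc2 B hB2 a ha).le) (by norm_num)
  have hv' : 67 < cnt E9 (R A) (R B) := by
    rw [okVal, Bool.or_eq_true, Nat.blt_eq] at hv
    rcases hv with hv | hv
    · exact hv
    · exact absurd hv (by simp [Nat.ble])
  refine lt_of_lt_of_le hv' ?_
  have key : ∀ A F, Good E A → Hits (R A) F → Hits A (F ∪ (E \ E9)) := by
    intro A F hA h a ha
    by_cases haE : a ⊆ E9
    · obtain ⟨x, hx, hxF⟩ := h (τ a) (Finset.mem_image_of_mem τ (Finset.mem_filter.2 ⟨ha, haE⟩))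
      exact ⟨x, hτs a hx, Finset.mem_union_left _ hxF⟩
    · obtain ⟨x, hx, hxE⟩ := Finset.not_subset.1 haE
      exact ⟨x, hx, Finset.mem_union_right _ (Finset.mem_sdiff.2 ⟨hA.1 a ha hx, hxE⟩)⟩
  unfold cnt
  apply Finset.card_le_card_of_injOn (fun F => F ∪ (E \ E9))
  · intro F hF
    simp only [Finset.coe_filter, Finset.mem_powerset, Set.mem_ofPred_eq] at hF ⊢
    exact ⟨Finset.union_subset (hF.1.trans hsub) Finset.sdiff_subset,
      key A F hA hF.2.1, key B F hB hF.2.2⟩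
  · intro F hF F' hF' he
    simp only [Finset.coe_filter, Finset.mem_powerset, Set.mem_ofPred_eq] at hF hF'
    simp only at he
    have hr : ∀ F ⊆ E9, (F ∪ (E \ E9)) ∩ E9 = F := by
      intro F hF
      ext x
      simp only [Finset.mem_inter, Finset.mem_union, Finset.mem_sdiff]
      constructor
      · rintro ⟨h | h, h'⟩
        · exact h
        · exact absurd h' h.2
      · intro h; exact ⟨Or.inl h, hF h⟩
    rw [← hr F hF.1, he, hr F' hF'.1]

theorem cnt_not_bad (n : ℕ) : ∀ (E : Finset ε) (A B : Finset (Finset ε)), E.card = n →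
    Good E A → Good E B → Simp A B → ¬ bad (cnt E A B) := by
  induction n using Nat.strong_induction_on with
  | _ n ih =>
    intro E A B hn hA hB hs
    by_cases h0 : ∅ ∈ A ∨ ∅ ∈ B
    · have : cnt E A B = 0 := by
        classical
        unfold cnt
        rw [Finset.card_eq_zero, Finset.filter_eq_empty_iff]
        rintro F - ⟨h1, h2⟩
        rcases h0 with h | h
        · obtain ⟨x, hx, -⟩ := h1 _ h; simp at hx
        · obtain ⟨x, hx, -⟩ := h2 _ h; simp at hx
      rw [this]; simp [bad]
    by_cases h1 : ∃ e, {e} ∈ A ∨ {e} ∈ B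
    · obtain ⟨e, he⟩ := h1
      obtain ⟨E', A', B', hlt, hA', hB', hs', heq⟩ := cnt_unit hA hB he
      rw [heq]
      exact ih _ (hn ▸ hlt) E' A' B' rfl hA' hB' (hs' hs)
    push Not at h0 h1
    have two : ∀ C : Finset (Finset ε), ∅ ∉ C → (∀ e, {e} ∉ C) → ∀ c ∈ C, 2 ≤ c.card := by
      intro C hC0 hC1 c hc
      by_contra hlt
      have : c.card = 0 ∨ c.card = 1 := by omega
      rcases this with h | h
      · rw [Finset.card_eq_zero] at h; exact hC0 (h ▸ hc)
      · obtain ⟨e, rfl⟩ := Finset.card_eq_one.1 h; exact hC1 e hc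
    have hA2 := two A h0.1 (fun e => (h1 e).1)
    have hB2 := two B h0.2 (fun e => (h1 e).2)
    by_cases h9 : 9 ≤ E.card
    · have := cnt_big hA hB hs hA2 hB2 h9
      unfold bad; omega
    · have hv := family_check E.card E.card (by omega) (check_small _ (by omega)) E rfl A B hA hB hs
        hA2 hB2 (fun a ha => Finset.card_le_card (hA.1 a ha))
        (fun a ha => Finset.card_le_card (hB.1 a ha)) id
      intro hb
      rw [okVal, Bool.or_eq_true, Nat.blt_eq] at hv
      rcases hv with hv | hv
      · unfold bad at hb; omega
      · rw [Bool.and_eq_true] at hv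
        have := hv.2
        rcases hb with h | h | h | h | h <;> rw [h] at this <;> exact absurd this (by decide)

end families
end ECov

/-- No finite simple bipartite graph has exactly 19, 37, 41, 59 or 67 edge covers. -/
theorem no_bipartite_graph_with_forbidden_cover_count
    (W : Type u) [Fintype W] (G : SimpleGraph W) (hbip : G.Colorable 2) :
    edgeCoverCount G ∉ ({19, 37, 41, 59, 67} : Set ℕ) := by
  classical
  obtain ⟨c⟩ := hbip
  let E := G.edgeFinset
  let inc : W → Finset (Sym2 W) := fun v => E.filter (v ∈ ·)
  let A : Fin 2 → Finset (Finset (Sym2 W)) := fun k => (Finset.univ.filter (c · = k)).image inc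
  have hmem : ∀ k a, a ∈ A k → ∃ v, c v = k ∧ inc v = a := by
    intro k a ha
    obtain ⟨v, hv, rfl⟩ := Finset.mem_image.1 ha
    exact ⟨v, (Finset.mem_filter.1 hv).2, rfl⟩
  have hend : ∀ e ∈ E, ∀ v ∈ e, ∀ w ∈ e, c v = c w → v = w := by
    intro e he v hv w hw hc
    by_contra hne
    have hvw : e = s(v, w) := (Sym2.mem_and_mem_iff hne).1 ⟨hv, hw⟩
    have : G.Adj v w := by
      rw [← SimpleGraph.mem_edgeSet, ← hvw]
      exact SimpleGraph.mem_edgeFinset.1 he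
    exact c.valid this hc
  have hgood : ∀ k, ECov.Good E (A k) := by
    intro k
    refine ⟨?_, ?_⟩
    · intro a ha
      obtain ⟨v, -, rfl⟩ := hmem k a ha
      exact Finset.filter_subset _ _
    · intro a ha a' ha' e he he'
      obtain ⟨v, hv, rfl⟩ := hmem k a ha
      obtain ⟨w, hw, rfl⟩ := hmem k a' ha'
      rw [Finset.mem_filter] at he he'
      rw [hend e he.1 v he.2 w he'.2 (hv.trans hw.symm)]
  have hsimp : ECov.Simp (A 0) (A 1) := by
    intro a ha b hb x hx y hy hx' hy'
    obtain ⟨v, hv, rfl⟩ := hmem 0 a ha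
    obtain ⟨w, hw, rfl⟩ := hmem 1 b hb
    rw [Finset.mem_filter] at hx hy hx' hy'
    have hne : v ≠ w := by
      rintro rfl
      rw [hv] at hw
      exact absurd hw (by decide)
    rw [(Sym2.mem_and_mem_iff hne).1 ⟨hx.2, hx'.2⟩, (Sym2.mem_and_mem_iff hne).1 ⟨hy.2, hy'.2⟩]
  have hcnt : edgeCoverCount G = ECov.cnt E (A 0) (A 1) := by
    unfold edgeCoverCount ECov.cnt
    rw [← Set.ncard_coe_finset, ← Set.ncard_image_of_injective _ Finset.coe_injective]
    congr 1
    have hiff : ∀ F ⊆ E, (ECov.Hits (A 0) F ∧ ECov.Hits (A 1) F) ↔ ∀ v : W, ∃ e ∈ F, v ∈ e := by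
      intro F hF
      constructor
      · rintro ⟨h0, h1⟩ v
        have hk : ∃ x ∈ inc v, x ∈ F := by
          have hc : c v = 0 ∨ c v = 1 := by omega
          rcases hc with hc | hc
          · exact h0 _ (Finset.mem_image_of_mem inc (by simpa using hc))
          · exact h1 _ (Finset.mem_image_of_mem inc (by simpa using hc))
        obtain ⟨x, hx, hxF⟩ := hk
        exact ⟨x, hxF, (Finset.mem_filter.1 hx).2⟩
      · intro h
        have hk : ∀ k, ECov.Hits (A k) F := by
          intro k a ha
          obtain ⟨v, -, rfl⟩ := hmem k a ha
          obtain ⟨e, he, hv⟩ := h v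
          exact ⟨e, Finset.mem_filter.2 ⟨hF he, hv⟩, he⟩
        exact ⟨hk 0, hk 1⟩
    ext S
    simp only [Set.mem_ofPred_eq, Set.mem_image, Finset.mem_coe, Finset.mem_filter,
      Finset.mem_powerset]
    constructor
    · rintro ⟨h1, h2⟩
      have hS : (S.toFinset : Set (Sym2 W)) = S := Set.coe_toFinset S
      have hSE : S.toFinset ⊆ E := by
        intro e he
        exact SimpleGraph.mem_edgeFinset.2 (h1 (Set.mem_toFinset.1 he))
      refine ⟨S.toFinset, ⟨hSE, (hiff _ hSE).2 ?_⟩, hS⟩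
      simpa using h2
    · rintro ⟨F, ⟨h1, h2⟩, rfl⟩
      refine ⟨fun e he => SimpleGraph.mem_edgeFinset.1 (h1 he), ?_⟩
      simpa using (hiff F h1).1 h2
  intro hb
  rw [hcnt] at hb
  exact ECov.cnt_not_bad _ E (A 0) (A 1) rfl (hgood 0) (hgood 1) hsimp (by
    simpa [ECov.bad] using hb)
end

section
/- For every natural number n with 1 ≤ n ≤ 1000 and n ∉ {19, 37, 41, 59, 67, 82, 97, 149, 197, 223, 257, 291, 379}, there exists a finite simple bipartite graph whose number of edge covers equals n. -/
open SimpleGraph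

namespace CoverSearch

/-- Bit mask of the endpoints of an edge. -/
def bits (e : ℕ × ℕ) : ℕ := 2 ^ e.1 ||| 2 ^ e.2

/-- Remove the endpoints of an edge from a mask. -/
def rem (U : ℕ) (e : ℕ × ℕ) : ℕ := U ^^^ (U &&& bits e)

/-- Number of ways to cover the mask `U` by edges of the list. -/
def cnt : List (ℕ × ℕ) → ℕ → ℕ
  | [], U => bif Nat.beq U 0 then 1 else 0
  | e :: L, U => cnt L U + cnt L (rem U e)

/-- Vertices met by the edges of the list. -/
def reach : List (ℕ × ℕ) → ℕ
  | [] => 0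
  | e :: L => bits e ||| reach L

/-- Insert a mask with multiplicity. -/
def ins (U c : ℕ) : List (ℕ × ℕ) → List (ℕ × ℕ)
  | [] => [(U, c)]
  | p :: t => bif Nat.beq U p.1 then (p.1, p.2 + c) :: t else p :: ins U c t

/-- Insert a mask unless it can no longer be covered. -/
def insP (R U c : ℕ) (st : List (ℕ × ℕ)) : List (ℕ × ℕ) :=
  bif Nat.beq (U &&& R) U then ins U c st else st

/-- One step of the dynamic program. -/
def step (R : ℕ) (e : ℕ × ℕ) : List (ℕ × ℕ) → List (ℕ × ℕ)
  | [] => []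
  | p :: t => insP R p.1 p.2 (insP R (rem p.1 e) p.2 (step R e t))

/-- Weighted sum of the counts. -/
def total (L : List (ℕ × ℕ)) : List (ℕ × ℕ) → ℕ
  | [] => 0
  | p :: t => p.2 * cnt L p.1 + total L t

/-- The dynamic program. -/
def run : List (ℕ × ℕ) → List (ℕ × ℕ) → ℕ
  | [], st => total [] st
  | e :: L, st => run L (step (reach L) e st)

theorem testBit_bits (e : ℕ × ℕ) (v : ℕ) : (bits e).testBit v = true ↔ e.1 = v ∨ e.2 = v := by
  simp [bits, Nat.testBit_or, Nat.testBit_two_pow]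

theorem testBit_rem (U : ℕ) (e : ℕ × ℕ) (v : ℕ) :
    (rem U e).testBit v = true ↔ U.testBit v = true ∧ ¬ (e.1 = v ∨ e.2 = v) := by
  rw [← testBit_bits]
  simp only [rem, Nat.testBit_xor, Nat.testBit_and]
  cases U.testBit v <;> cases (bits e).testBit v <;> simp

theorem testBit_reach (L : List (ℕ × ℕ)) (v : ℕ) :
    (reach L).testBit v = true ↔ ∃ e ∈ L, e.1 = v ∨ e.2 = v := by
  induction L with
  | nil => simp [reach]
  | cons e L ih => simp [reach, Nat.testBit_or, ih, testBit_bits]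

/-- `S` covers the mask `U`. -/
def Cov (U : ℕ) (S : Finset (ℕ × ℕ)) : Prop :=
  ∀ v, U.testBit v = true → ∃ e ∈ S, e.1 = v ∨ e.2 = v

open Classical in
theorem card_cov (L : List (ℕ × ℕ)) (hL : L.Nodup) (U : ℕ) :
    (L.toFinset.powerset.filter (Cov U)).card = cnt L U := by
  induction L generalizing U with
  | nil =>
    by_cases hU : U = 0
    · subst hU
      simp [cnt, Cov, Finset.filter_singleton]
    · have : ¬ Cov U ∅ := by
        intro h
        apply hU
        apply Nat.eq_of_testBit_eq
        intro i
        have := h i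
        simpa using this
      have hb : Nat.beq U 0 = false := by
        rw [← Bool.not_eq_true, Nat.beq_eq]; exact hU
      simp [cnt, Finset.filter_singleton, this, hb]
  | cons e L ih =>
    rw [List.nodup_cons] at hL
    have he : e ∉ L.toFinset := by simpa using hL.1
    rw [List.toFinset_cons, Finset.powerset_insert, Finset.filter_union,
      Finset.card_union_of_disjoint, ih hL.2, cnt, Finset.filter_image,
      Finset.card_image_of_injOn]
    · congr 1
      rw [← ih hL.2]
      congr 1
      apply Finset.filter_congr
      intro S _
      constructor
      · intro h v hv
        rw [testBit_rem] at hv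
        obtain ⟨f, hf, hfv⟩ := h v hv.1
        rcases Finset.mem_insert.1 hf with rfl | hf
        · exact absurd hfv hv.2
        · exact ⟨f, hf, hfv⟩
      · intro h v hv
        by_cases hev : e.1 = v ∨ e.2 = v
        · exact ⟨e, Finset.mem_insert_self _ _, hev⟩
        · obtain ⟨f, hf, hfv⟩ := h v ((testBit_rem _ _ _).2 ⟨hv, hev⟩)
          exact ⟨f, Finset.mem_insert_of_mem hf, hfv⟩
    · intro S hS T hT hST
      simp only [Finset.coe_filter, Finset.mem_powerset, Set.mem_ofPred_eq] at hS hT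
      have h1 : e ∉ S := fun h => he (hS.1 h)
      have h2 : e ∉ T := fun h => he (hT.1 h)
      have hST : insert e S = insert e T := hST
      rw [← Finset.erase_insert h1, hST, Finset.erase_insert h2]
    · rw [Finset.disjoint_left]
      intro S hS hT
      simp only [Finset.mem_filter, Finset.mem_powerset, Finset.mem_image] at hS hT
      obtain ⟨⟨T, _, rfl⟩, _⟩ := hT
      exact he (hS.1 (Finset.mem_insert_self _ _))

theorem cnt_eq_zero (L : List (ℕ × ℕ)) (U : ℕ) (h : U &&& reach L ≠ U) : cnt L U = 0 := by
  induction L generalizing U with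
  | nil =>
    have hb : Nat.beq U 0 = false := by
      rw [← Bool.not_eq_true, Nat.beq_eq]
      rintro rfl
      simp at h
    simp [cnt, hb]
  | cons e L ih =>
    have key : ∃ v, U.testBit v = true ∧ (reach (e :: L)).testBit v = false := by
      by_contra hc
      push Not at hc
      apply h
      apply Nat.eq_of_testBit_eq
      intro i
      have := hc i
      rw [Nat.testBit_and]
      cases h1 : U.testBit i <;> simp_all
    obtain ⟨v, hv, hr⟩ := key
    rw [reach, Nat.testBit_or, Bool.or_eq_false_iff] at hr
    have aux : ∀ W : ℕ, W.testBit v = true → cnt L W = 0 := by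
      intro W hW
      apply ih
      intro hc
      rw [← hc, Nat.testBit_and, hr.2] at hW
      simp at hW
    rw [cnt, aux U hv, aux]
    rw [testBit_rem]
    refine ⟨hv, ?_⟩
    rw [← testBit_bits, hr.1]
    simp

theorem total_ins (L : List (ℕ × ℕ)) (U c : ℕ) (st : List (ℕ × ℕ)) :
    total L (ins U c st) = c * cnt L U + total L st := by
  induction st with
  | nil => simp [ins, total]
  | cons p t ih =>
    cases hb : Nat.beq U p.1 with
    | true =>
      have := Nat.eq_of_beq_eq_true hb
      simp only [ins, hb, cond_true, total]
      rw [this]; ring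
    | false =>
      simp only [ins, hb, cond_false, total, ih]
      ring

theorem total_insP (L : List (ℕ × ℕ)) (U c : ℕ) (st : List (ℕ × ℕ)) :
    total L (insP (reach L) U c st) = c * cnt L U + total L st := by
  cases hb : Nat.beq (U &&& reach L) U with
  | true => simp only [insP, hb, cond_true, total_ins]
  | false =>
    have : U &&& reach L ≠ U := Nat.ne_of_beq_eq_false hb
    simp [insP, hb, cnt_eq_zero L U this]

theorem total_step (L : List (ℕ × ℕ)) (e : ℕ × ℕ) (st : List (ℕ × ℕ)) :
    total L (step (reach L) e st) = total (e :: L) st := by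
  induction st with
  | nil => simp [step, total]
  | cons p t ih => simp only [step, total, total_insP, ih, cnt]; ring

theorem run_eq (L st : List (ℕ × ℕ)) : run L st = total L st := by
  induction L generalizing st with
  | nil => rfl
  | cons e L ih => rw [run, ih, total_step]

/-- The graph on `Fin (k + 1)` with given edge list. -/
def mkGraph (k : ℕ) (L : List (ℕ × ℕ)) : SimpleGraph (Fin (k + 1)) :=
  SimpleGraph.fromRel fun a b => (a.val, b.val) ∈ L

/-- All edges go from `[0, l)` to `[l, k]`. -/
def valid (k l : ℕ) : List (ℕ × ℕ) → Bool
  | [] => true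
  | e :: L => Nat.blt e.1 l && (Nat.ble l e.2 && (Nat.ble e.2 k && valid k l L))

/-- Edge membership test. -/
def memE (e : ℕ × ℕ) : List (ℕ × ℕ) → Bool
  | [] => false
  | f :: L => (Nat.beq e.1 f.1 && Nat.beq e.2 f.2) || memE e L

/-- Duplicate-freeness test. -/
def nodupE : List (ℕ × ℕ) → Bool
  | [] => true
  | e :: L => !(memE e L) && nodupE L

theorem memE_iff (e : ℕ × ℕ) (L : List (ℕ × ℕ)) : memE e L = true ↔ e ∈ L := by
  induction L with
  | nil => simp [memE]
  | cons f L ih => simp [memE, ih, Prod.ext_iff]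

theorem nodupE_spec (L : List (ℕ × ℕ)) (h : nodupE L = true) : L.Nodup := by
  induction L with
  | nil => simp
  | cons e L ih =>
    simp only [nodupE, Bool.and_eq_true, Bool.not_eq_true'] at h
    rw [List.nodup_cons, ← memE_iff]
    exact ⟨by simp [h.1], ih h.2⟩

theorem valid_spec (k l : ℕ) (L : List (ℕ × ℕ)) (h : valid k l L = true) :
    ∀ e ∈ L, e.1 < l ∧ l ≤ e.2 ∧ e.2 ≤ k := by
  induction L with
  | nil => simp
  | cons e L ih =>
    simp only [valid, Bool.and_eq_true, Nat.blt_eq, Nat.ble_eq] at h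
    intro f hf
    rcases List.mem_cons.1 hf with rfl | hf
    · exact ⟨h.1, h.2.1, h.2.2.1⟩
    · exact ih h.2.2.2 f hf

/-- The edge of the graph given by a pair of labels. -/
def toE (k : ℕ) (e : ℕ × ℕ) : Sym2 (Fin (k + 1)) := s(Fin.ofNat (k + 1) e.1, Fin.ofNat (k + 1) e.2)

theorem mem_toE (k : ℕ) (e : ℕ × ℕ) (h1 : e.1 ≤ k) (h2 : e.2 ≤ k) (v : Fin (k + 1)) :
    v ∈ toE k e ↔ e.1 = v.val ∨ e.2 = v.val := by
  simp only [toE, Sym2.mem_iff, Fin.ext_iff, Fin.val_ofNat]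
  rw [Nat.mod_eq_of_lt (by omega), Nat.mod_eq_of_lt (by omega)]
  omega

theorem toE_injOn (k l : ℕ) (L : List (ℕ × ℕ)) (h : ∀ e ∈ L, e.1 < l ∧ l ≤ e.2 ∧ e.2 ≤ k) :
    Set.InjOn (toE k) {e | e ∈ L} := by
  intro e he f hf hef
  have h1 := h e he
  have h2 := h f hf
  simp only [toE, Sym2.eq_iff, Fin.ext_iff, Fin.val_ofNat] at hef
  rw [Nat.mod_eq_of_lt (by omega), Nat.mod_eq_of_lt (by omega), Nat.mod_eq_of_lt (by omega),
    Nat.mod_eq_of_lt (by omega)] at hef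
  apply Prod.ext <;> omega

theorem edgeSet_mkGraph (k l : ℕ) (L : List (ℕ × ℕ))
    (h : ∀ e ∈ L, e.1 < l ∧ l ≤ e.2 ∧ e.2 ≤ k) :
    (mkGraph k L).edgeSet = Set.image (toE k) {e | e ∈ L} := by
  ext x
  induction x using Sym2.ind with
  | _ a b =>
    simp only [SimpleGraph.mem_edgeSet, mkGraph, SimpleGraph.fromRel_adj, Set.mem_image,
      Set.mem_ofPred_eq]
    constructor
    · rintro ⟨_, hab | hab⟩
      · refine ⟨_, hab, ?_⟩
        simp [toE]
      · refine ⟨_, hab, ?_⟩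
        simp [toE]
    · rintro ⟨e, he, hx⟩
      have h1 := h e he
      simp only [toE, Sym2.eq_iff, Fin.ext_iff, Fin.val_ofNat] at hx
      rw [Nat.mod_eq_of_lt (by omega), Nat.mod_eq_of_lt (by omega)] at hx
      refine ⟨by rw [ne_eq, Fin.ext_iff]; omega, ?_⟩
      rcases hx with hx | hx
      · left; rw [← hx.1, ← hx.2]; exact he
      · right; rw [← hx.1, ← hx.2]; exact he

theorem colorable_mkGraph (k l : ℕ) (L : List (ℕ × ℕ))
    (h : ∀ e ∈ L, e.1 < l ∧ l ≤ e.2 ∧ e.2 ≤ k) : (mkGraph k L).Colorable 2 := by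
  refine ⟨SimpleGraph.Coloring.mk (fun v => if v.val < l then 0 else 1) ?_⟩
  intro a b hab
  simp only [mkGraph, SimpleGraph.fromRel_adj] at hab
  rcases hab.2 with hab | hab
  · have := h _ hab
    simp only at this
    rw [if_pos this.1, if_neg (by omega)]
    simp
  · have := h _ hab
    simp only at this
    rw [if_pos this.1, if_neg (by omega)]
    simp

open Classical in
theorem count_mkGraph (k l : ℕ) (L : List (ℕ × ℕ))
    (h : ∀ e ∈ L, e.1 < l ∧ l ≤ e.2 ∧ e.2 ≤ k) (hL : L.Nodup) :
    edgeCoverCount (mkGraph k L) = cnt L (2 ^ (k + 1) - 1) := by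
  rw [← card_cov L hL, edgeCoverCount, edgeSet_mkGraph k l L h, ← Set.ncard_coe_finset]
  have hinj := toE_injOn k l L h
  have himg : {E' : Set (Sym2 (Fin (k + 1))) | E' ⊆ Set.image (toE k) {e | e ∈ L} ∧
      ∀ v, ∃ e ∈ E', v ∈ e} = Set.image (fun S : Finset (ℕ × ℕ) => Set.image (toE k) (S : Set (ℕ × ℕ)))
        ((L.toFinset.powerset.filter (Cov (2 ^ (k + 1) - 1)) : Finset (Finset (ℕ × ℕ))) :
          Set (Finset (ℕ × ℕ))) := by
    have hcov : ∀ S : Finset (ℕ × ℕ), (∀ e ∈ S, e ∈ L) →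
        ((∀ v, ∃ e ∈ Set.image (toE k) (S : Set (ℕ × ℕ)), v ∈ e) ↔ Cov (2 ^ (k + 1) - 1) S) := by
      intro S hS
      have hm : ∀ e ∈ S, ∀ v : Fin (k + 1), v ∈ toE k e ↔ e.1 = v.val ∨ e.2 = v.val := by
        intro e he v
        have := h e (hS e he)
        exact mem_toE k e (by omega) (by omega) v
      constructor
      · intro hv v hvb
        rw [Nat.testBit_two_pow_sub_one, decide_eq_true_eq] at hvb
        obtain ⟨_, ⟨e, he, rfl⟩, hve⟩ := hv ⟨v, hvb⟩
        exact ⟨e, he, (hm e he _).1 hve⟩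
      · intro hv v
        obtain ⟨e, he, hve⟩ := hv v.val (by
          rw [Nat.testBit_two_pow_sub_one, decide_eq_true_eq]; exact v.isLt)
        exact ⟨_, ⟨e, he, rfl⟩, (hm e he v).2 hve⟩
    ext E'
    simp only [Set.mem_ofPred_eq, Set.mem_image, Finset.coe_filter, Finset.mem_powerset]
    constructor
    · rintro ⟨hE, hv⟩
      have hSE : Set.image (toE k) ((L.toFinset.filter (fun e => toE k e ∈ E') : Finset (ℕ × ℕ)) :
          Set (ℕ × ℕ)) = E' := by
        ext x
        constructor
        · rintro ⟨e, he, rfl⟩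
          simp only [Finset.coe_filter, Set.mem_ofPred_eq] at he
          exact he.2
        · intro hx
          obtain ⟨e, he, rfl⟩ := hE hx
          refine ⟨e, ?_, rfl⟩
          simp only [Finset.coe_filter, Set.mem_ofPred_eq, List.mem_toFinset]
          exact ⟨he, hx⟩
      refine ⟨L.toFinset.filter (fun e => toE k e ∈ E'), ⟨Finset.filter_subset _ _, ?_⟩, hSE⟩
      rw [← hcov, hSE]
      · exact hv
      · intro e he
        simpa using (Finset.mem_filter.1 he).1
    · rintro ⟨S, ⟨hS, hc⟩, rfl⟩
      have hSL : ∀ e ∈ S, e ∈ L := fun e he => by simpa using hS he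
      exact ⟨Set.image_mono hSL, (hcov S hSL).2 hc⟩
  rw [himg, Set.ncard_image_of_injOn]
  intro S hS T hT hST
  simp only [Finset.coe_filter, Finset.mem_powerset, Set.mem_ofPred_eq] at hS hT
  have hSL : (S : Set (ℕ × ℕ)) ⊆ {e | e ∈ L} := fun e he => by simpa using hS.1 he
  have hTL : (T : Set (ℕ × ℕ)) ⊆ {e | e ∈ L} := fun e he => by simpa using hT.1 he
  exact Finset.coe_injective ((hinj.image_eq_image_iff hSL hTL).1 hST)

/-- Read an edge list from base-32 digits (with fuel). -/
def dec : ℕ → ℕ → List (ℕ × ℕ)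
  | 0, _ => []
  | f + 1, x => bif Nat.beq x 0 then [] else (x % 32, x / 32 % 32) :: dec f (x / 1024)

/-- Check of an edge list against a claimed count. -/
def chkL (n k l : ℕ) (L : List (ℕ × ℕ)) : Bool :=
  valid k l L && (nodupE L && Nat.beq (run L [(2 ^ (k + 1) - 1, 1)]) n)

/-- Check of a code against a claimed count. -/
def chk (n x : ℕ) : Bool := chkL n (x % 32) (x / 32 % 32) (dec 20 (x / 1024))

/-- `n` is the number of edge covers of a bipartite graph. -/
def Good (n : ℕ) : Prop :=
  ∃ (m : ℕ) (G : SimpleGraph (Fin m)), G.Colorable 2 ∧ edgeCoverCount G = n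

theorem good_of_chk (n x : ℕ) (h : chk n x = true) : Good n := by
  unfold chk at h
  generalize x % 32 = k at h
  generalize x / 32 % 32 = l at h
  generalize dec 20 (x / 1024) = L at h
  simp only [chkL, Bool.and_eq_true, Nat.beq_eq] at h
  have hv := valid_spec k l L h.1
  refine ⟨k + 1, mkGraph k L, colorable_mkGraph k l L hv, ?_⟩
  rw [count_mkGraph k l L hv (nodupE_spec L h.2.1), ← h.2.2, run_eq]
  simp [total]

/-- The exceptional values. -/
def exc : List ℕ := [19, 37, 41, 59, 67, 82, 97, 149, 197, 223, 257, 291, 379]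

/-- Check a table of codes for consecutive values starting at `n`. -/
def chkAll : ℕ → List ℕ → Bool
  | _, [] => true
  | n, x :: t => (bif Nat.beq x 0 then exc.any (Nat.beq n) else chk n x) && chkAll (n + 1) t

theorem good_of_chkAll (T : List ℕ) (a : ℕ) (h : chkAll a T = true) (n : ℕ) (h1 : a ≤ n)
    (h2 : n < a + T.length) (h3 : n ∉ exc) : Good n := by
  induction T generalizing a with
  | nil => simp at h2; omega
  | cons x t ih =>
    rw [chkAll, Bool.and_eq_true] at h
    by_cases hn : n = a
    · subst hn
      cases hx : Nat.beq x 0 with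
      | true =>
        rw [hx, cond_true, List.any_eq_true] at h
        obtain ⟨⟨y, hy, hny⟩, _⟩ := h
        rw [Nat.eq_of_beq_eq_true hny] at h3
        exact absurd hy h3
      | false =>
        rw [hx, cond_false] at h
        exact good_of_chk n x h.1
    · refine ih (a + 1) h.2 (by omega) ?_
      simp only [List.length_cons] at h2
      omega

/-- Graph codes for `n = 1, …, 100` (`0` marks an exceptional value). -/
def codes0 : List ℕ := [
  32801,
  104253685827,
  141941253668932,
  182538860067127397,
  182572944927588453,
  223849343739144274022,
  106722521841731,
  144257129329524804,
  184648852563350847557,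
  184649979597162643557,
  268255040771057206296711,
  226897440488496765698150,
  268255076799854225260679,
  313342263425124753800822920,
  150062368543817695333,
  226897440521482114531430,
  230403510882106832191622,
  228077996114502018498662,
  0,
  271067602929909047035560071,
  272275346932889740900401255,
  271066422338255344275423367,
  228078032143299037462630,
  317226030063673771442326077576,
  149990275731047940196,
  189080423934156840435781,
  232341796197659825275994182,
  320901161049267915638662365320,
  361830594955741083537955258537,
  236008789901651443781337223,
  197323163637955612683403399,
  191405903763713455915109,
  272276491856036628302790791,
  232342976790407576499093606,
  322101665745745524969586196648,
  277572012932598576267653120103,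
  0,
  319701834620085345023105826952,
  318462761212844076033355415688,
  195999645526066122427826278,
  0,
  367979227959881997218793375531145,
  190262170728178705858661,
  277572012933787561788044345479,
  281325805558513456349437886600,
  232342979094032870759563366,
  318463970138663690662530121864,
  324838213256201025336784493609096,
  200819657262213006923267145831,
  241672998495804280973346078855,
  197285310955145157702451334,
  277572012932598609253001953383,
  282487546637083467222440116391,
  277572015291510911675234615399,
  329950984236443746243422439243945,
  324840730236216877118094389182632,
  234759650142733226744053862,
  365445165982769104468435997458601,
  0,
  278809954152439582547805044839,
  278811202037852521864542421127,
  289386167409213148789526631710889,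
  233551904914738181109284966,
  281248396490231641978257408135,
  289386167446989774810574091354281,
  241673000856987488323308224647,
  0,
  324839451196204570183401929310344,
  277572015292626678482915655783,
  324838213254984693149424270049416,
  278809955331912058757814780007,
  280046686447720823243583651975,
  289386167446990927732078698201257,
  329950985445369601886848632914089,
  278809954152475610245312381031,
  419688972723555939910833195179999402,
  278809954152475611344824008807,
  329871719804935138509791768510632,
  197209753019326430609277061,
  237917999306402570368190578758,
  284232503301758794156939096948807,
  0,
  418389710086446740070746013269393578,
  206908256376955403281282113863816,
  289346475994480187305510138183848,
  324839451196204570150416580477064,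
  380748132814941027524095041184399562,
  374214577366450809364832468202586281,
  281248396490232768977675878535,
  324839454821797978609072872751240,
  517573794879083411560364703769635782860,
  324839454819475994731780031774856,
  288077624891916662444302287372424,
  241673000822399877269963276423,
  422245942865221270995076949471330506,
  328602830018000917533052043919496,
  0,
  295031974718347595114330850379038857,
  339169113863024813149305202656084169,
  379367577053919389535929213638574249]

/-- Graph codes for `n = 101, …, 200` (`0` marks an exceptional value). -/
def codes1 : List ℕ := [
  422285200303690210291350149726929098,
  289346475994482493147419840250024,
  248781618101552888603694239744168,
  241595591791011516994627436678,
  211955264518500394629290585539870857,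
  284233741242978672284965219172455,
  206947986401754422865608172503176,
  332634330373100784010114182150193256,
  418390977735913600344258795121311914,
  337869806620178391456656441617842345,
  329871719804900550898738423562408,
  287998358081520514656394109124744,
  241673000859292204298743709831,
  328641168682446840230787252617352,
  432462960274517696949890380895789187275,
  374215849966352022389767711408423081,
  327374756021113009127793342152840,
  474996798221364670764522567104932806859,
  474956720338444180092293522523479539915,
  376810728270313816877532202276094089,
  328641168682409910714942326177928,
  376812036773007394542898695943389353,
  375511385165968695531838437071126665,
  337869810333996187328886988125405353,
  432462959006865963353705090684234694859,
  375512655291276674852628094148280457,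
  379286490782056402097093282139111593,
  379367620383105281642335997553442985,
  328602791331121428126528931233928,
  327374717298888511023214225391752,
  417092863908407562160600800460701866,
  337869810330372915904371595371774121,
  326107105422028511635863836426376,
  254792941793920940182670469958369449,
  326107105420884815755093657911432,
  247393885993995865426042065911943,
  419689051951756233071006048378323114,
  376811998393241724679908093207937193,
  376812036773008575098491715847356585,
  332634330373100785199099702541418632,
  327374756022219849801012934213768,
  376810729507079167500298652928311433,
  297630778531418346384897518826881225,
  378107536073570639121348951032365225,
  327374756021113045156590361116808,
  328641168682446840231886764245128,
  327374754814475774728605777657992,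
  374215849963975491457263562454630569,
  0,
  379406798709357612085675574211805353,
  239157149453254359294129832038,
  378107536073570602191833106105925801,
  337869770758640696574427698900926633,
  284233741242980975910259479642215,
  375512652817777849580854562949038217,
  432379845493982955940139142726430163146,
  375511385165968695567867234090090633,
  378110032958736539712392025461653673,
  248742003982443073624442486816935,
  332634330373100784010147167499026536,
  339087984147201103599276903683522760,
  332634332846601968194223120930930792,
  375513924179818124184044900572102825,
  337869809096058472331042285676560553,
  376810729507080348055891672832278665,
  247473114232103696936646905823367,
  254792941793920940253602164089454761,
  303443308866526886018989017724665102506,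
  389927666944698038253868268784042836171,
  296290791418347709496160457672786088,
  378107536071116187987795929165070473,
  296331435465719888284553295681454249,
  378107536071116186763942730427138185,
  254793060597365748626851549329653929,
  432296768626684444003773753570046968010,
  253331339373872009717564632666865800,
  285501393052135024926385357553767,
  379367620383107645131420441589743785,
  376810728270351595773367461930467465,
  332634330373103142922449589731688552,
  254793060520071234555930219752095913,
  428431060593297632665263007281635786890,
  286767806920069198033333971419239,
  383194429149029782616242012438996877481,
  379367620383106463386879319083221161,
  333932405825675710758253086384423016,
  429762925302370955587526122740685930698,
  332635598024913477564213466832699528,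
  384523658409949526409785886722486272105,
  428432361201571900013109698969250988202,
  375512655291237715365173216594231433,
  435989815289331078320900282624525822230698,
  337788641042817057315456484020224168,
  247473152879879512699286530949255,
  388555558091170872816913359445315190954,
  337869810256628476612418161019617449,
  0,
  294991448313964809253470314141188232,
  376810729507081527528367882842013833,
  296290791418347709496126372812325032]

/-- Graph codes for `n = 201, …, 300` (`0` marks an exceptional value). -/
def codes2 : List ℕ := [
  379406877898910021092582801069473961,
  428432358668751412977316873607519043754,
  379367620383107645095392744082407593,
  347309172595733742929060248462865662153,
  296290870646512550356094347833933993,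
  379406838323514353259691093356871849,
  285501393052135026017066532569191,
  337788641042817021610917538715304104,
  531357984414136376870048003175025071063276,
  335231750164410830116017891920969864,
  337869810331581804830499176639004841,
  253412469012362209966433432967970952,
  332634332847771935606120883213664360,
  383194429146512801384058043768877744265,
  333932407062405642513253507295969384,
  383195731021244456849506842933201076361,
  267254960117777932265732991672354817081515,
  389886087965357784229807118543459909834,
  260949672912279153588553276565240316074,
  345978681975350101797424961301556396201,
  260949672991390050298385926822968852650,
  248742003982479895019777136165031,
  0,
  388472443351492952244258453267387941034,
  259577405642037303089044673299235340425,
  389886047440191343809826107579319910602,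
  429762925302370955624455639685123997898,
  333932405826923596171192403121799304,
  346020264761353557594103198090585604266,
  442842068724956528213747694420797272817867,
  333932405825676889077807791787311208,
  345978684510651302253883764294962806953,
  333932405825676890230729296394158184,
  296290791418350070679367807634931880,
  431089396158097843908822290662819004586,
  442842071321104957481161508686045437427915,
  333932405825675710794280783891759208,
  444204492414501923441243103276143237890283,
  333932405825675710794281883403386984,
  335229213626441484717224909542129800,
  248662775744370873468121849692326,
  291054083381001005215614920848113735,
  340616256226602627897301848760017551432,
  383195727223245628787284857330667258025,
  253453112982285181549109642537336968,
  389802970611191565201277693284621418697,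
  337869810256628476648446958038581417,
  442842073917250953182081030356467678642379,
  287998358005998355433106847170695,
  431089477208469523674914081448755626154,
  427103129405315900453699127930442121386,
  285502633408882253655148461162631,
  486228075738931758390426741316293090279627,
  385855525655559572009624674537249603753,
  428431063128598831978059741720834375850,
  383197030363109690785832362574377812137,
  0,
  286770282802510070088010981048455,
  486228075738852647493716908666035361743051,
  332635601735143418605377938016829576,
  296290791418312330980647089171759272,
  525913466542094172897659458220038453133516,
  482312125888262595845759366375796579139755,
  345978645256845653080545541486509457577,
  347309172595698725434432907044653826249,
  259577486771675793289293542099536445577,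
  431049275016560802562004026187994792106,
  389802970611191565203581318578881888457,
  524552337074410419043804806869906285068492,
  253453112982360775116282653833298056,
  432379845455649089381634649506227355850,
  345895568427844705652891703303576125609,
  294991448313964810369237121822228616,
  304815496235126758506188614270732927178,
  483675955350352439481309813105446116065483,
  385855486354679522531639976694938501289,
  247473152878735779663751780892807,
  483675957947766044640021362712515312812235,
  344648158443124004794591993521651187849,
  435991144516017127510876792025602064548010,
  336489297938432939552754578546098312,
  383195731023679235772194616369249124489,
  260949672912279153588624208259371401386,
  435989815286758641295760454350791583629482,
  254752376935990194752739321533595816,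
  385854187015249067518002230489809813641,
  337788641042817021612044538133774504,
  296290791418350036090595703297048744,
  384526296389651802609683174612252393641,
  388472443272302264068063755538528370857,
  0,
  347309172595698725435585828549260673225,
  482314828480081051674981655123143820509387,
  259577486771675793290446463604143292553,
  483675957947766044602242394821860643766475,
  482313455118833297365645405910310901186763,
  429761589198521012666598586572838437034,
  333933675950986051332125191273840776,
  428432361200375064668023437531375894698,
  303401770452005802696469709724525428905]

/-- Graph codes for `n = 301, …, 400` (`0` marks an exceptional value). -/
def codes3 : List ℕ := [
  304815494967476158276806291269422874826,
  384524956485404518042275115031012180105,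
  253453112982360776269204158440145032,
  399243351475312291139612313127617577550026,
  254752376935990157931343986884247720,
  336528556730825564396361332159545480,
  588755537383638569343554239406539748835295469,
  383195727221968999582266758748721774729,
  345978645256848073291097106152440365225,
  296290830955023442428347044130357416,
  357092123405996814627498129663149788594411,
  385851589601684974546963797834622730409,
  428432361201614213633092403638430761130,
  347309172595698725434432872959793365193,
  333933675952193796526306887100137608,
  383197030363110903249968074841965887657,
  335231748930023156429765254288900232,
  347309172595698725436738748954355892425,
  304773836165723524574212379299784360137,
  296209661702526398021700689948999847,
  304773917255749028998051631970818130121,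
  340617554302055202824087109410222080104,
  444076886405177374204398165463356525478122,
  335231748930060935360467160457674888,
  588713512595659321734874617444275559791296749,
  303443389877284331048732070455797776553,
  482313455117526031361860499584353562689707,
  296290791418350036091756754289983656,
  480952328244721815929457865376998776537259,
  387184714314565423966560502940520579241,
  486396721378677422787387068029814207348939,
  345978645256845653080545574471858290857,
  429761589197399129505996210698711105706,
  335231748930060935361628211450609800,
  387182116936822902049598032563274907785,
  354282132783578520465201805415648709476522,
  480952324351768061740932138133287556251819,
  442842071318572174474403603348271009038539,
  486355638748245637345618458884178087968971,
  399243312578755933681226156345952806568138,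
  485037047175072355127602417342899739099339,
  345978685782012095822510462728839266473,
  452118597058009532226764907968892942065762476,
  399285930951374501366483250234004930232523,
  335231750166827503468343542165930120,
  485034387419778531649733325776524383781035,
  312173644897919838124724515209188401676491,
  303443389916859729077711082986267639977,
  499554130562912086126965876978165797152325869,
  397880890187284757921921142096888229691562,
  385854187012814290954226792461343260809,
  354197062191769021459150364413549101613226,
  483674587180088088002821012117282298691755,
  385854185748840031784533175862688874633,
  482313455117526029019566724081009536696491,
  385855525655559572011928299831510073513,
  304773836165800857975137826616591450313,
  483674585883283999887199873037359386886315,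
  384526297659775865064844107400404435113,
  267127228479163692273258901696680571338922,
  482313455117526030228492543695638711402667,
  355729787904366019843264399382931258409163,
  389802970649490298533741292246217720009,
  387184713087729334063748872572546220201,
  333933675950986051333215872448856200,
  387182116936822976464916546312701345929,
  482314828480083490075998634588754380259531,
  491100021103944020684893090649915858180309195,
  385854187014052229815155463333913690249,
  388512644275712276452124257779286442153,
  260907972396974967263013875600383443113,
  303401770452005802661880937620187545769,
  486396804536556797833613007387047261044939,
  399243312578755937306783824204980937752778,
  437350946052512895966743553654237725589642,
  345895568427844705652892830302994596009,
  385854185748762587335432259112630616201,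
  310768526289943236405092877165284047356074,
  0,
  438714737870409625609883745833763022733482,
  387184713087690648437521204438955622569,
  429761589196161189466746859220830945450,
  385854187015212724186737889035738546313,
  387182116939336334460261361042621366441,
  437353647343728026794183995569327405433002,
  442756961746584743687976819843430701269194,
  484993180052566096121477852610213793923243,
  345978685781977036976081291474540593321,
  385855525655560780937747914460684779689,
  397880891482824950397547314419912807710890,
  387182116936822976427987030467774906505,
  303443389877284333409915311890620383401,
  485034387380478888409284359019465615245483,
  260908093972552868701231859389159342249,
  486396846114228797242608739023911278280907,
  397880852583734529676347096402164053082282,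
  483675957947766044677800258547774967185611,
  438713406047535539043812333694135614701706,
  385854185748801272923613482443109171337,
  335231750165619758240348496531161224]

/-- Graph codes for `n = 401, …, 500` (`0` marks an exceptional value). -/
def codes4 : List ℕ := [
  438716104742602238261548681760977755242698,
  267212299070971917111599724305857158217898,
  441435667579053875812207275109834031268010,
  345978685702787484567075511247101395113,
  387182116898445625139504442054379962505,
  385854185750116623176031800434127700137,
  487718141621589483530573801300864100696299,
  385854185750116660954962502340296474793,
  442842070023031984414270190638364218294475,
  399243395655509348999737300150472704983243,
  385854185748840032965088768882592841865,
  399243312578759651124579696435527445315786,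
  482313455117526030228492579724435730366635,
  437352277837359941540593977038713548570762,
  304773836165800820195053042154822893769,
  442756961746584706249053037809874233393354,
  345978645256848072112740396750111670441,
  296290791418348892357560168546992296,
  528635767015836548883987483324562744213708,
  440075867335601403788124841298954553557162,
  483674587178821636729021965320486012485803,
  387184714314565426327743710290482725033,
  387141875367279581175715337458099028105,
  303318693583387031574293530051346596008,
  486396846115495209903905640611060262305995,
  438714737867916411993051465835249821450410,
  486355681587308047949905646135467739119819,
  392391095446029108613734850908580820942985,
  384524959018227420533936283078065520777,
  438713407344339626060302745941543617691786,
  336528556730825564397452013334560904,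
  446453570853635778084457792337570476677267594,
  482314788237248774381954378939550337794251,
  440077238107038987875850992081832731934922,
  483674587178861289536045475164705471496363,
  399243354076526371047781903477752958484682,
  485037047175072355127530936209614114586827,
  345978685782012095824814088023099736233,
  385855486357154196045573238150477807785,
  347309172595737373210247578935458201801,
  385854187012814290955342559269024301193,
  438714696333306119373893820242733603913898,
  303443389877244438895912221064927805609,
  441394456318886519517461294989733083119786,
  442842073795561446111438034258199897637067,
  442714426489937489455711164937764111319242,
  438714778112018820600943969619416765857962,
  418726203586159618450097714173542757435063861452,
  365706059322662162138198697480658561609728236,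
  362871974967212035441384508144203222566994091,
  385854187014052230994627939543923425417,
  399243312578755936057721348250473599271114,
  347309172595737335431315715978296492233,
  303443389877284333412218937184880853161,
  480952286706346948820803169292779763433643,
  438713406048844041775168966951283951042730,
  384524956485404518007687469892806770825,
  354324751115626040559728672555156319142058,
  384524956485404516863991589122628255881,
  385854185748840034108820678449790320777,
  399243395655509385267439254535657226436811,
  397880852583735768825312165369370619576490,
  543937797708390148406912070590060948692893932,
  399243312578755933680009824125607234175178,
  273669036625308697792702367490395440674930859,
  384526254560858301897186958085640585385,
  357049588069527263993153204931579168915690,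
  399243312578759647501308271920134691684554,
  385854187014052229815191492130932654217,
  310768567909368514935806322767450142310570,
  385854185748838826327854369695028347017,
  440077235509627858559442573946852546379978,
  483674587180088088078378875843196622110891,
  438714735276801446925372007767741495935146,
  292353426485385087203937967572877415,
  454865400232449969603829397168859925610463467,
  385854187015251484191354556140054773897,
  340617554302055202826390734704482549864,
  437352275281776332691770506477423883845770,
  440073207584031311276394140024205832519850,
  437350946052512895966743589683034744553610,
  435992473745285513540426856480173138804906,
  304732297751241126843369156077397672136,
  392391095446029108613733661956045778550889,
  400520701900882768483356525410372414570729,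
  355687211110611586652432439033296790421706,
  319709409890697689611651625269862757770133708,
  354324710875209024102342510892143983362218,
  399285929653300290357228359271575873323211,
  354324751074984471525584504683488277069994,
  442714426410154807175100585238837141373130,
  499423376980307934988772433489910685709336811,
  387182116936822975283169753390381138057,
  345978685742401641345140763113851879593,
  437352277876657110147669088485111347937418,
  387184714354140784145127575892164509865,
  492496586455576418729759035435402657892860107,
  399243312578758409560088394886157032423626,
  345978645256846864330652691688134443177,
  441435667539715931382794156767791055798442]

/-- Graph codes for `n = 501, …, 600` (`0` marks an exceptional value). -/
def codes5 : List ℕ := [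
  267212465062134123174395494932843038146730,
  442842072617913924860385876492620197462219,
  541324426430566055482355597598351009863925996,
  438713406048844003016308047257864371339434,
  385854185748840032965124797679611805833,
  303443389916897167927707230996718059689,
  304773836165799649084986685817459245257,
  495284180938509894445241449474465040779378891,
  437353648644336266000321818136606188667050,
  385854185748840032928230149547425398921,
  254711812078059449358872188859613351,
  440073207584031311276357210508360906080426,
  387184714354102099699492689526978150569,
  340617554302057618352587289170821611624,
  480953658768297369927800017053536330383563,
  399243312578759651124579696468512794149066,
  345978645256848072112776425547130634409,
  493890384363601729260954247205390540525994187,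
  437352275281778807360562074381909684781194,
  388472443272302228614574567373377011881,
  354324750993894369821019394435375700279466,
  385855486357156577260826975501818167465,
  437353608401459460344906082962615744757930,
  399243354076491709975746692409857381957834,
  399243354035966466165289437580281491161290,
  303401770412351826924181528597454028968,
  312130943570130864402708721648170747232458,
  438713406048844041776349522544303855009962,
  492496585126348421704486453353778986684186827,
  388512644275712276417536646725941493929,
  387184713087690648436368282934348775593,
  362872060037803844940390559585238307523690667,
  437352275281739193280483261767818315694218,
  442798084737625073885902092860553005564106,
  499336264611299307443613873225018996664008939,
  399158241905860125329582686431660791234761,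
  341946783565493134453720497727805161576,
  499336264611299424931747389857551839823888619,
  345978685781977036976082418473959063721,
  392391095446031582114917846031999210455145,
  486396763040014361886929982012183009231051,
  441435667579053948347789886677133251739818,
  438713406047536775848122479944260839932042,
  345978685782014475860629056925689086121,
  442756961746584743689157411465247624200394,
  397880852583734532054058620527030418178218,
  293652769589770348628743646020239495,
  438714737871680987652514848486704237674666,
  440073207584031308821943006471183965225098,
  303443389877284333375327700837275435177,
  440073207584031308821941782617985227292810,
  441394458912498410815529710461998868889770,
  544110575997239278860961600614825353244016876,
  399243312578755937270185483962741187346634,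
  341946783565491927853343557890640805992,
  495284180938509894448864720898980433533010123,
  438713406047535539119370197420049938120842,
  392391095446029108616092574258468011212905,
  437353604511043479647918013474821787254954,
  310598342229388436352320096070136087347369,
  343274714753476077953513339275452711016,
  302071243073499964675552510966149283976,
  441435667579053875812206122188329424421034,
  393752226211788315042513908491691736793193,
  544068466137409600838771050161810612729118956,
  440075825760464706787327337661496536760490,
  384526258360132550238607460626294014121,
  446453570853635780601437808189351786572841130,
  438714778112018820600944005648213784821930,
  441435667579053952008804502521825703657642,
  319709411219925606285670788341019560321941708,
  495282777272407666887433953584976815422865579,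
  440075866042558182273141764332749553041578,
  260866433982453921721625310842086129832,
  399243312578720075767908279423826678448330,
  399243312578759612441277792330663812333770,
  345978685702787560051117357969474486441,
  354282132743009948754514408861011181469865,
  303401770412351826925334450102060875944,
  408868790635712200659627560881258153828876491,
  495285542066685843480238479812673534179901675,
  345978645256848072075881777414944227497,
  437353608401500309949568348641994198909098,
  392392424675292545342300119829405392568457,
  440075866042559380355297670884282454933674,
  364267261691039041952923772610863492849926347,
  355687128074504659450556842634318413234378,
  362872060037803844942808411224467565873103019,
  399158241905860125329583839353165398081737,
  440075867339364741506368346916431310520490,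
  440077197865475597914131940347035919777994,
  408825152122189561170709598872604945659658443,
  485037047175111967924303232116362781589707,
  352919672747988544749634233150414746943625,
  310768567909408089122549451845421221707946,
  354282132743011186694553694241286080594089,
  435991148408972118354955777151319385702538,
  399243354035966466165289437546196630700234,
  442756961746584706250234782353195763171530,
  408825152122189564884530897320399473117167819]

/-- Graph codes for `n = 601, …, 700` (`0` marks an exceptional value). -/
def codes6 : List ℕ := [
  437353608402727110945134312364112447963306,
  310725948279323531283480494751885356597418,
  397880892783431951665969023307511740137642,
  355687128074504659524968702350568670298314,
  345978685742401641308249526766246461609,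
  354324751075063738333621741295973641126058,
  438714737870410864798987810793839520809130,
  393753555441054224059837307122870544105609,
  495285542066685843441552853585005400589304043,
  355687128074504620840562265667294472634570,
  493890383031782656813291915605589824597328075,
  441435667579053952008843701885967685288106,
  397795781910837519613480558984302413643945,
  440075867336869055597278890316179943096490,
  399243312578758413185684108061922631549130,
  440073207584031311276394140025305344147626,
  544068466097209827864923335000524284531802348,
  355687211110610348712393153653021891297482,
  267212465062173853199194514517169096786090,
  399243354035966466165291743422191193227466,
  319665642400480400458542007350451313320329419,
  493888978040346654950349625333026805503918251,
  347309172595737335468137111312945840329,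
  495280053686883552188043512074147490313732299,
  493890383031782656851977503786813155075883211,
  303401810937519438419570248696803262632,
  397880852583735769995278461500325221269674,
  399243353995401608272362138878465592721610,
  438714735276801450550967719851692048679082,
  354282132742972851692230347204870805815465,
  438713407344340864002702059391048430518410,
  355644592737995494844856992097716830142665,
  442756961785842222053792488056677749424330,
  440075866042519766274042844557395385024682,
  310768608068618795729771758671526818381994,
  410220311115512544173416549320422976120914154,
  438713406047535539119370233448846957084810,
  410263867300016838821415720632560811367432427,
  341946783565491927853344648571815821416,
  399158241905860125329548134814220093161673,
  438714735276722222389597155898468310614186,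
  395114687501121831521599734209940472070281,
  542715459537872258004865904603866146839658700,
  446454931984401537290885356287979445268119690,
  399243312578759612442494090742126342242506,
  446453570853635778084456576005383116453707914,
  393752227508593639925845770462690229190761,
  440075866042559380354082525394324531871914,
  440075866042480113507159448692767515115690,
  438713406048844041776349558573100873973930,
  441394501751562063022014462202013611622570,
  438713406047538014961633014922307958898858,
  442756961746584706251416490866620762357962,
  440075867339285516895112911964949572649130,
  355687128074425470085898830686304577192138,
  399243312578759612442495243662531437461706,
  441434338311758522571506171895959552950442,
  373054277377033606394832664295420877740271927500,
  387184713087690648473189678268998123689,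
  438713406048844041776312663924968687567018,
  542715416922055267574433108665121605113020620,
  303401770412390474699997291237079154856,
  442798126235474698352853025537283504406730,
  495280053686883552188043475144631645387292875,
  410263867300016838821453497258581858827075819,
  440075867336869058012805050841849263194282,
  493890383031782656890737545262099594559553739,
  392392424675296255572238857368582316228745,
  442756961746584706176966620735430637846730,
  496675212717853139657045707388978675857916075,
  397880894081504967046479203823539691094186,
  362872060037803844942809591780060585777070251,
  355644592738074723009697852065691851751626,
  364267302855526781937449793826104883523289291,
  304732297751279774690592868441056805064,
  441435667579053952010024257478987589255338,
  365662460602821437595962419577931754025222379,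
  498070285311355241680888812381328973395853515,
  399243353995401685605763064325782399811786,
  388472443272302228614575658054552027305,
  539927867719840777119063271973067371063738572,
  399243312578759573756868979966700339527882,
  399243354076490471997965404683569759191242,
  354324751074984471525584505810487695540394,
  496675212717853179271126963368227067534672043,
  438713406047538014999411946785265120608426,
  496675212717853100004278823993114047988007083,
  387184673749746217846081054756892213417,
  407473634259301771221187431817725428721942699,
  304732297751279736911661005483895095496,
  441351966415132126543375420625922486861994,
  310683412902248309458386188590794330505385,
  392391095446031583284885257929761493188713,
  397880893959814223169130363770968089985194,
  354324751075063738334802296888993545093290,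
  393752226213096817700672706092155663417481,
  397880852583734532056418648596260331880618,
  343277310904382435552345663369560326280,
  437353608401501547889534999968578378301610,
  407430031547886679206329978924208540289761450]

/-- Graph codes for `n = 701, …, 800` (`0` marks an exceptional value). -/
def codes7 : List ℕ := [
  393752226211789551772445663492112648339561,
  446454931984405300628603599793596922025083018,
  354324751075063735915770102067814803341482,
  464264324047952492842656125748570214542201782476,
  550034469582794077179689916440254192769971749100,
  493888978040306091372706774094397124781441195,
  602885844633023646123643587125725542570772365549,
  495282775944482812248045019771003196053553323,
  345978685742401641345141853795026895017,
  410263867300097928807100003095297767778779371,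
  453470283730211004210149319631959734299590859,
  407430034206342670776161724731822660850450602,
  498028172747676194990591204424095544234934475,
  395114686206812192547359668493284626530441,
  542673264485351974407861871884225973869281484,
  309320952947831297599631364204134945390729,
  354324710875248638259083684907663128428714,
  493890384363604265803719194965775889694130379,
  393752226211788315043693380967901746528361,
  446454931984405336569965894952612007849885834,
  453470241197551853616771839940783737051218123,
  303443389916897166783974195461968003241,
  441394458915033714397201423002343615660202,
  408868793252670425509536104481830048876396747,
  393752226211788315042513944520488755757161,
  499423377020467067592802710054280118128574699,
  304649220922276331529112511815493025991,
  354282132743009948754476364669074108743849,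
  401807120605968048014034487255710391177642057,
  454865400232414515037412178581330081918189803,
  497897549556585111033490630433334573438009547,
  393752226211788316290399321431008474169481,
  440075867339403121274330181830494950424746,
  440075825760464706787329641286790797230250,
  407473634217686069706191838957157201125474475,
  318052702609007882017140916634308801808466090,
  602885844505417758409451837407202787651892773101,
  355644592737995494847218175339151652749513,
  493890383031782656852015320763995015442792651,
  310725948238757396764812780223407363096745,
  365662334367619162600657900900810895361540331,
  364267175332837551590268438417457795398041803,
  454865400232414515038622320733166156176916715,
  395112027748284084746268462086181687001225,
  399243312578759648710197198047715958915274,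
  364267302814030239538978704368110304095305931,
  319665642400480400575807811782138649135743179,
  408825152080646076089575581794665565144678602,
  407473634217767237680890854558723369456533675,
  454778287863405925790986946133413254557565162,
  493890384363604265726274745864859139635871947,
  502885027813862470943168332669775363253591015627,
  397880852583737006727535660266219318182058,
  495282775944401607095324617327195887165931691,
  492495180136210496498131320621962808113922219,
  361389744935481219606015821952251984972218506,
  492496546578735235442931356214702014403379403,
  354324751075063738335981769365203554828458,
  438714737870452916036955283709039776792746,
  496677934979386002474030312338844520447934667,
  493888978040224961771695710374538499296755883,
  354282132743012424634554935429623906992297,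
  658325766458449557024678967057094948936330848239886,
  355687128074504620840562265668393984262346,
  454865442766412226676865003516485980030992619,
  495282777272370825794319269528322808184209579,
  493890383031782656890736364706507674167214283,
  496675212720488664560488237120917150678319307,
  441394501751562063023193934678223621357738,
  440075867339364741506370650541725570990250,
  538535428288015653875462090928980865530921164,
  446454931984401538571137832730626405316067498,
  408868708265194623259300746284696617286303947,
  440075867335601407413720553349919757467818,
  493887616909580898145982107128130060052234411,
  453470283691229481841716635340575781316395211,
  495282775944361002662036056818151498384048299,
  495284180938512429750065177357816412288254155,
  399243354035966466165291743423290704855242,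
  493888978041685296502420895653319448201461963,
  441438327334387348392403335805195551703242,
  449243932786706004643557505430038781091807402,
  437353608401501550306241785891962314981546,
  408825152080648611390776038253468558551089354,
  495282775944481549473042622047402260451983531,
  496675212677609114080505848567019159102324907,
  441435667579053950727864827827715743842474,
  364267302814070725168749298986757272610472139,
  495282777271153959248105076948841353149841579,
  364267302855526781937452155009346318345896139,
  440075866042559418965294553693216097599658,
  407429993045744158388577102428315603385352362,
  492495180136206694748004047789848601288671403,
  319665812375471064403317984245020084685439179,
  495284139732445789615935491295634384773906635,
  312131068144769762062452952880992055656650,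
  495284139728551563335623320998783059591626955,
  355644592737995494847220478964445913219273,
  399243312578758413112487356644615128285386,
  493890343154942744963494507729304163509797067]

/-- Graph codes for `n = 801, …, 900` (`0` marks an exceptional value). -/
def codes8 : List ℕ := [
  355644592737995494809478476618433189576905,
  552888963609734983984447744941212104672397197548,
  397880894040943861659293719116469885894826,
  453470282362040664383053092880108297694413003,
  410220311115512544138399054693081557909078250,
  453383128828502777536488261216082929318559946,
  345895568427844630130733607015732641960,
  449243888923444681652826457844211049186885802,
  355687211110649885385764902632258386723018,
  496675212677611648143767410627523649715994795,
  441394501751562063022014498230810630586538,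
  495282775945821416580917121967926013451239627,
  410263867300097928768415595505694088485896427,
  492495184119996458217283729035647747459547307,
  496679337313664084618362255769737841070014699,
  495282775945821456194997161648762942598086859,
  440075866042559419003073485556173259309226,
  440075825760464707996255460901419971936426,
  495282777269855886269105713891827899691073707,
  310726031234259890528193956758969716474025,
  498028217985482751403460566282588372431208651,
  352919714245758980909662200275456388890761,
  497984661842598000918626238215706397886316747,
  453470283566654803252532293880910253721321675,
  345935769431254677897881936231540097192,
  319665811170856925533838783244218128658530507,
  542673264485351974407861871920254770888245452,
  362784903928804239749380762124191195329626282,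
  493890384363604265803720375521368909598097611,
  495282775945821376928150238572061385581330635,
  493888978040346653753514280210736570609860779,
  446456298426930077988189195645304021987786922,
  362872102656095330158260160076678667010474155,
  344607838243271697764009377616376266920,
  542673261868474922525477090958248840890876108,
  555697417431059384027217581875022970039033856204,
  496675212677609114078090285513005342363123883,
  440075867339285516970596953811671945740458,
  440075867338136669890808782138766849638570,
  408825152080609357585126864915245750097739978,
  499423377020507631174068756659542869525364971,
  495282777272408934539243107633994040812404907,
  493887616909580898223427736784639830014460075,
  496677936265816884793317663737848710861881547,
  310725948238757396689290693092932870897833,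
  355644634235805466509469886763899103150281,
  496675212717853217722258181488257545577595051,
  408738039711600768337532813361905034502275274,
  352919672747988545919601645048177029677193,
  364267302897146207215980507271707049618243787,
  552888963609734983984447744904282588827470758124,
  449243891576746405880881160429385067176034474,
  454865400232455040168794964972816740468883691,
  498070371752756404309338940109814854584565963,
  493888980697542603065120182972728578744156331,
  310683412942853941963509307414132948107433,
  396433321915814838946337645749865420030089,
  446454935970787449193058044756469510547046538,
  399243353995401685605761911404277792964810,
  502885027809830654928164434773458983796630257835,
  496675212677611648143767373698007804789555371,
  498070285352974666959419525826931139490808011,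
  492495180136210496498130142338436899729997995,
  341948081640946918307479419277826719880,
  399243312578759573756869015995497358491850,
  408868793252670421792092715201140846076559563,
  408868793294168235596085303132905634676277451,
  446454931985743979315249309262829491337724074,
  557215354500557851636326882474736264060980134125,
  453470283691264976054861977713216377606832331,
  399243354076490472035670515793234877415626,
  392392424675296255572241160993876576698505,
  440075867339364706447521918872176430317738,
  440075866042480190877157561460819465765034,
  395114686206772542122771271983033783287945,
  354282132743012427050083435609384506523817,
  440075867336869058012805086870646282158250,
  495284139731146446590169404562785543928348875,
  495282775944482814723849542747853143234740395,
  454865400232455040168794966125737145564102891,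
  399158241905860125329548135941219511632073,
  355644592738035070205035559204753334534345,
  492495184120038290726984665494031017804202155,
  446454931984405336528864739069624894099685514,
  354282132742972851692231462971678486855849,
  410220311115512544138399055846003062515925226,
  442756961746584706139186535950968869290186,
  496675212677610381731106076796420655805530283,
  447850134879977499437244449508310200761876650,
  496677936304759072856186472513385208698044619,
  551460323480253058820844351753080119772838035660,
  395114686208119460855624829687524491428009,
  496677934979386002473992460808955570073829579,
  303401770412389264630444641073154392232,
  492496546578735235442931319321213866984276171,
  316831811885998687488107570206656562804686986,
  312088408233700889164030298959399220347081,
  551460239092842935675758124526482180208729456844,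
  341948084173809715385775515225850773640,
  355644592737995494847183586567047314866377]

/-- Graph codes for `n = 901, …, 1000` (`0` marks an exceptional value). -/
def codes9 : List ℕ := [
  408825152080609357585129224943347965360275658,
  451987969793599589711427325533660959847121066,
  496633016373827682428393249556857927720140971,
  318139814895020771902277740782680134771703978,
  493888980696203963953833543068238290197053611,
  446454931984401537294510949696405116211560586,
  602884448158054287154687591381064435929184436461,
  392392428565754323813895040975780586848393,
  407473634217767238918830893915035338486743211,
  393753558034705730683502965361470701961353,
  397795781910837482175739674414472570765481,
  309363571239316513050199660822216178794633,
  440075867336869019328322556173964045090986,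
  447848729888541498774689976024851662613119114,
  408868708265194702604729065051653240776753355,
  447848729888541498775898901844466291787825290,
  498028172750272343422239833492098143739904203,
  446454931984405339004744817640385443897933962,
  442756961746584706176965467813926030999754,
  464353565050025743791230308405718227140445667531,
  454865400232414515040964614472640703183945963,
  495282778602938767917652224678862614725591243,
  601413990047896471144590332789796740284993962189,
  343277312169594631258679322286131118216,
  495284139728551563335623284105294912172523723,
  408868708265194742216353510950177410495217867,
  407429993045746696163278743071227535572500650,
  408825152080646076088326519318711057806196938,
  495284139731146446590169367633269699001909451,
  310725948238757396764884260265944166858921,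
  557126109283542943595707920741696833172751483116,
  354282132743009948754478668294368369213609,
  440075867338136708613033316272142985363626,
  449242527792677658467268528232080609646870666,
  492496546578736506803724924841400448279838923,
  502886421609109452983544437012528427210108993707,
  555739238092744006541291936873397687835492024524,
  318226927181032394136663149567303948439814314,
  496633015045896494445449786658596342538076331,
  364223619148292731740733396556512081234559178,
  558554752135283806664515178554917705057172717836,
  393754884670318898726085292120353466908841,
  327382394894150083607154297632820312743574962380,
  464353567772284679158738016112715086594591359179,
  309363571239316514259125480436845353500809,
  495282777269855883795606887503161660903948459,
  493888980694946452197451752215026517038760107,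
  449243888923444681651577395368256541848404138,
  399243312578757174001301219541465235128522,
  447848729888538964676373070112924628255113354,
  498070327888230046523158228652015998982095051,
  318183371038027295995599546402238085164335274,
  312088408233700889163993477564064570998985,
  395114686206772542198364839156045079249033,
  552887572536744346227561460523694758012639183052,
  446454931984401537294508627712527823370584202,
  408825152080609357587547075466810416028647626,
  355644634195241885243386424078047903940809,
  421583444499890503736611189469480493828167434508,
  447847368760411185169803784022554482422481066,
  325908932601156105748438627697300386789122539691,
  410220311115512544138399054693047473048617194,
  393753558035972143344836726624551167983753,
  447848729888538964673956365632844253532127370,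
  492495180136169931641446138589535500811534507,
  410220311115512544138399056998923467611144426,
  365618778183114867880126757927257090027651306,
  355559522065135544407679674020176024764616,
  365618863212169451284154048129623356067774698,
  401808481736733807220463267539400768455016553,
  512793579346643751566051854104648092594364219659,
  364180062963707426338881732344365998770684106,
  552887572536743048154582461160637744559180415180,
  510070137672178401719844874614879847802323796172,
  345895568427844630058028620531370197160,
  464398173393839277054243975116253863489050968268,
  408868708265192206878885279938964338866585803,
  557169142752627040243305439812919504066167668972,
  303401770412390473556264255702329098408,
  453339572643998522508618590540919249578426570,
  495282775944482815845808261213954931685490859,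
  418726247227290099313194974971518245807644147916,
  597178249063728424176092259036128618315484725485,
  449239805531144877395467850196788500314095786,
  496675212677611609728940565435049486269448363,
  496675212717853216448010227535361700960305323,
  493888938162207438340801796812778003610370219,
  310726031234339118766301788269574556385449,
  602885801076880678974634104799559996551437975789,
  396474487743306727900074543459391657607305,
  557215312349446601315074170994645219245688062189,
  561773793820292526438609222955866542944148410040556,
  495282775944481549434356998089548339056115883,
  504316504530510252779270835652850032078949122251,
  556992304684745872262743512566240541839246721260,
  408825152080648611389526975777514051212607690,
  454865400232455040207442740787488631273259243,
  447850095003137587511211554091322046951882922,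
  493888980696203964031279172724748060159279275,
  450637686827540240664617509339975415522033834]

theorem chk0 : chkAll 1 codes0 = true := by decide +kernel

theorem chk1 : chkAll 101 codes1 = true := by decide +kernel

theorem chk2 : chkAll 201 codes2 = true := by decide +kernel

theorem chk3 : chkAll 301 codes3 = true := by decide +kernel

theorem chk4 : chkAll 401 codes4 = true := by decide +kernel

theorem chk5 : chkAll 501 codes5 = true := by decide +kernel

theorem chk6 : chkAll 601 codes6 = true := by decide +kernel

theorem chk7 : chkAll 701 codes7 = true := by decide +kernel

theorem chk8 : chkAll 801 codes8 = true := by decide +kernel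

theorem chk9 : chkAll 901 codes9 = true := by decide +kernel

end CoverSearch

open CoverSearch in
/-- For every `1 ≤ n ≤ 1000` outside the exceptional set
`{19, 37, 41, 59, 67, 82, 97, 149, 197, 223, 257, 291, 379}`, there is a finite simple
bipartite graph with exactly `n` edge covers. -/
theorem exists_bipartite_graph_with_cover_count (n : ℕ) (h1 : 1 ≤ n) (h2 : n ≤ 1000)
    (h3 : n ∉ ({19, 37, 41, 59, 67, 82, 97, 149, 197, 223, 257, 291, 379} : Set ℕ)) :
    ∃ (m : ℕ) (G : SimpleGraph (Fin m)), G.Colorable 2 ∧ edgeCoverCount G = n := by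
  have he : n ∉ exc := by
    intro h
    apply h3
    simpa [exc] using h
  change Good n
  by_cases b0 : n ≤ 100
  · exact good_of_chkAll codes0 1 chk0 n (by omega) (lt_of_le_of_lt b0 (by decide +kernel)) he
  by_cases b1 : n ≤ 200
  · exact good_of_chkAll codes1 101 chk1 n (by omega) (lt_of_le_of_lt b1 (by decide +kernel)) he
  by_cases b2 : n ≤ 300
  · exact good_of_chkAll codes2 201 chk2 n (by omega) (lt_of_le_of_lt b2 (by decide +kernel)) he
  by_cases b3 : n ≤ 400
  · exact good_of_chkAll codes3 301 chk3 n (by omega) (lt_of_le_of_lt b3 (by decide +kernel)) he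
  by_cases b4 : n ≤ 500
  · exact good_of_chkAll codes4 401 chk4 n (by omega) (lt_of_le_of_lt b4 (by decide +kernel)) he
  by_cases b5 : n ≤ 600
  · exact good_of_chkAll codes5 501 chk5 n (by omega) (lt_of_le_of_lt b5 (by decide +kernel)) he
  by_cases b6 : n ≤ 700
  · exact good_of_chkAll codes6 601 chk6 n (by omega) (lt_of_le_of_lt b6 (by decide +kernel)) he
  by_cases b7 : n ≤ 800
  · exact good_of_chkAll codes7 701 chk7 n (by omega) (lt_of_le_of_lt b7 (by decide +kernel)) he
  by_cases b8 : n ≤ 900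
  · exact good_of_chkAll codes8 801 chk8 n (by omega) (lt_of_le_of_lt b8 (by decide +kernel)) he
  by_cases b9 : n ≤ 1000
  · exact good_of_chkAll codes9 901 chk9 n (by omega) (lt_of_le_of_lt b9 (by decide +kernel)) he
  omega
end

section
/- For every natural number n with 1 ≤ n ≤ 256 and n ∉ {19, 37, 41, 57, 59, 67, 79, 82, 97, 111, 131, 149, 177, 179, 197, 201, 205, 223, 237, 251}, there exists a finite tree (connected acyclic finite simple graph) whose number of edge covers equals n. -/
open SimpleGraph

/-- `Realized t a`: there is a finite rooted tree (with edges indexed by `ι`) such that `t` edge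
subsets cover all non-root vertices, and `a` edge subsets cover all the vertices. -/
def Realized (t a : ℕ) : Prop :=
  ∃ (V ι : Type) (_ : Finite V) (_ : Finite ι) (G : SimpleGraph V) (r : V) (f : ι → Sym2 V),
    G.Connected ∧ Function.Injective f ∧ Set.range f = G.edgeSet ∧ Nat.card ι + 1 = Nat.card V ∧
    {S : Set ι | ∀ v, v ≠ r → ∃ i ∈ S, v ∈ f i}.ncard = t ∧
    {S : Set ι | ∀ v, ∃ i ∈ S, v ∈ f i}.ncard = a

theorem realized_leaf : Realized 1 0 := by
  refine ⟨Unit, Empty, inferInstance, inferInstance, ⊥, (), Empty.elim, ?_, ?_, ?_, ?_, ?_, ?_⟩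
  · exact Connected.of_subsingleton
  · intro x; exact x.elim
  · simpa using (inferInstance : IsEmpty Empty)
  · simp
  · have : {S : Set Empty | ∀ v, v ≠ () → ∃ i ∈ S, v ∈ (Empty.elim i : Sym2 Unit)} = {∅} := by
      ext S
      simp [Set.eq_empty_of_isEmpty S]
    rw [this, Set.ncard_singleton]
  · have : {S : Set Empty | ∀ v, ∃ i ∈ S, v ∈ (Empty.elim i : Sym2 Unit)} = ∅ := by
      ext S
      simp
    rw [this, Set.ncard_empty]

/-- Subsets of `Option (α ⊕ β)` as triples. -/
def splitEquiv (α β : Type) : Prop × (Set α × Set β) ≃ Set (Option (α ⊕ β)) where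
  toFun x := fun o => match o with
    | none => x.1
    | some (.inl i) => i ∈ x.2.1
    | some (.inr j) => j ∈ x.2.2
  invFun S := (none ∈ S, {i | some (.inl i) ∈ S}, {j | some (.inr j) ∈ S})
  left_inv x := by
    rfl
  right_inv S := by
    ext o
    rcases o with _ | (i | j) <;> rfl

theorem ncard_split {α β : Type} [Finite α] [Finite β] (P : Set (Set (Option (α ⊕ β))))
    (A A' : Set (Set α)) (B B' : Set (Set β))
    (h1 : ∀ X Y, splitEquiv α β (True, X, Y) ∈ P ↔ X ∈ A ∧ Y ∈ B)
    (h0 : ∀ X Y, splitEquiv α β (False, X, Y) ∈ P ↔ X ∈ A' ∧ Y ∈ B') :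
    P.ncard = A.ncard * B.ncard + A'.ncard * B'.ncard := by
  have hP : P = splitEquiv α β '' (({True} ×ˢ (A ×ˢ B)) ∪ ({False} ×ˢ (A' ×ˢ B'))) := by
    ext S
    obtain ⟨⟨p, X, Y⟩, rfl⟩ := (splitEquiv α β).surjective S
    rw [(splitEquiv α β).injective.mem_set_image]
    by_cases hp : p
    · obtain rfl : p = True := by simpa using hp
      simp [h1]
    · obtain rfl : p = False := by simpa using hp
      simp [h0]
  rw [hP, Set.ncard_image_of_injective _ (splitEquiv α β).injective, Set.ncard_union_eq]
  · simp [Set.ncard_prod]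
  · rw [Set.disjoint_left]
    rintro ⟨p, X, Y⟩ h h'
    have e1 : p = True := h.1
    have e2 : p = False := h'.1
    simp [e1] at e2

/-- Edge indexing of the grafted tree. -/
def graftEdge {V W α β : Type} (r : V) (s : W) (f : α → Sym2 V) (g : β → Sym2 W) :
    Option (α ⊕ β) → Sym2 (V ⊕ W)
  | none => s(.inl r, .inr s)
  | some (.inl i) => (f i).map .inl
  | some (.inr j) => (g j).map .inr

theorem cover_inl {V W α β : Type} (r : V) (s : W) (f : α → Sym2 V) (g : β → Sym2 W)
    (p : Prop) (X : Set α) (Y : Set β) (v : V) :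
    (∃ o ∈ splitEquiv α β (p, X, Y), Sum.inl v ∈ graftEdge r s f g o) ↔
      (p ∧ v = r) ∨ ∃ i ∈ X, v ∈ f i := by
  constructor
  · rintro ⟨_ | (i | j), ho, hv⟩
    · left
      exact ⟨ho, by simpa [graftEdge] using hv⟩
    · right
      exact ⟨i, ho, by simpa [graftEdge] using hv⟩
    · simp [graftEdge] at hv
  · rintro (⟨hp, rfl⟩ | ⟨i, hi, hv⟩)
    · exact ⟨none, hp, by simp [graftEdge]⟩
    · exact ⟨some (.inl i), hi, by simpa [graftEdge] using hv⟩

theorem cover_inr {V W α β : Type} (r : V) (s : W) (f : α → Sym2 V) (g : β → Sym2 W)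
    (p : Prop) (X : Set α) (Y : Set β) (w : W) :
    (∃ o ∈ splitEquiv α β (p, X, Y), Sum.inr w ∈ graftEdge r s f g o) ↔
      (p ∧ w = s) ∨ ∃ j ∈ Y, w ∈ g j := by
  constructor
  · rintro ⟨_ | (i | j), ho, hv⟩
    · left
      exact ⟨ho, by simpa [graftEdge] using hv⟩
    · simp [graftEdge] at hv
    · right
      exact ⟨j, ho, by simpa [graftEdge] using hv⟩
  · rintro (⟨hp, rfl⟩ | ⟨i, hi, hv⟩)
    · exact ⟨none, hp, by simp [graftEdge]⟩
    · exact ⟨some (.inr i), hi, by simpa [graftEdge] using hv⟩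

theorem realized_graft {t a t' a' : ℕ} (h : Realized t a) (h' : Realized t' a') :
    Realized (t * (t' + a')) (t * t' + a * a') := by
  obtain ⟨V, α, _, _, G, r, f, hG, hf, hfr, hc, ht, ha⟩ := h
  obtain ⟨W, β, _, _, H, s, g, hH, hg, hgr, hc', ht', ha'⟩ := h'
  refine ⟨V ⊕ W, Option (α ⊕ β), inferInstance, inferInstance,
    (G ⊕g H) ⊔ edge (.inl r) (.inr s), .inl r, graftEdge r s f g, hG.sum_sup_edge hH,
    ?_, ?_, ?_, ?_, ?_⟩
  · have hi : Function.Injective (Sym2.map (Sum.inl : V → V ⊕ W)) :=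
      Sym2.map.injective Sum.inl_injective
    have hj : Function.Injective (Sym2.map (Sum.inr : W → V ⊕ W)) :=
      Sym2.map.injective Sum.inr_injective
    have k1 : ∀ x : Sym2 V, s(Sum.inl r, Sum.inr s) ≠ x.map (Sum.inl : V → V ⊕ W) := by
      intro x
      induction x with | _ x y => simp
    have k2 : ∀ x : Sym2 W, s(Sum.inl r, Sum.inr s) ≠ x.map (Sum.inr : W → V ⊕ W) := by
      intro x
      induction x with | _ x y => simp
    have k3 : ∀ (x : Sym2 V) (y : Sym2 W),
        x.map (Sum.inl : V → V ⊕ W) ≠ y.map (Sum.inr : W → V ⊕ W) := by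
      intro x y
      induction x with | _ x x' => induction y with | _ y y' => simp
    rintro (_ | (i | j)) (_ | (i' | j')) hh
    · rfl
    · exact (k1 _ hh).elim
    · exact (k2 _ hh).elim
    · exact (k1 _ hh.symm).elim
    · rw [hf (hi hh)]
    · exact (k3 _ _ hh).elim
    · exact (k2 _ hh.symm).elim
    · exact (k3 _ _ hh.symm).elim
    · rw [hg (hj hh)]
  · have F : ∀ x y, G.Adj x y ↔ ∃ i, f i = s(x, y) := by
      intro x y
      rw [← mem_edgeSet, ← hfr]; rfl
    have F' : ∀ x y, H.Adj x y ↔ ∃ i, g i = s(x, y) := by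
      intro x y
      rw [← mem_edgeSet, ← hgr]; rfl
    apply Set.Subset.antisymm
    · rintro _ ⟨_ | (i | j), rfl⟩
      · simp [graftEdge]
      · obtain ⟨x, y, hxy⟩ : ∃ x y, f i = s(x, y) := by
          induction f i with | _ x y => exact ⟨x, y, rfl⟩
        have : G.Adj x y := (F x y).2 ⟨i, hxy⟩
        simp [graftEdge, hxy, this]
      · obtain ⟨x, y, hxy⟩ : ∃ x y, g j = s(x, y) := by
          induction g j with | _ x y => exact ⟨x, y, rfl⟩
        have : H.Adj x y := (F' x y).2 ⟨j, hxy⟩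
        simp [graftEdge, hxy, this]
    · intro e
      induction e with
      | _ x y =>
        intro he
        rw [mem_edgeSet, sup_adj] at he
        rcases he with he | he
        · rcases x with x | x <;> rcases y with y | y
          · obtain ⟨i, hi⟩ := (F x y).1 (by simpa using he)
            exact ⟨some (.inl i), by simp [graftEdge, hi]⟩
          · simp at he
          · simp at he
          · obtain ⟨i, hi⟩ := (F' x y).1 (by simpa using he)
            exact ⟨some (.inr i), by simp [graftEdge, hi]⟩
        · rw [edge_adj] at he
          refine ⟨none, ?_⟩
          rcases he.1 with ⟨rfl, rfl⟩ | ⟨rfl, rfl⟩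
          · rfl
          · exact Sym2.eq_swap
  · rw [Finite.card_option, Nat.card_sum, Nat.card_sum]
    omega
  · rw [mul_add, ← ht, ← ht', ← ha']
    apply ncard_split
    · intro X Y
      simp only [Set.mem_ofPred_eq, Sum.forall, cover_inl, cover_inr]
      simp only [ne_eq, Sum.inl.injEq, reduceCtorEq, not_false_eq_true, true_and, true_imp_iff]
      refine and_congr (forall_congr' fun v => ?_) (forall_congr' fun v => ?_) <;> tauto
    · intro X Y
      simp only [Set.mem_ofPred_eq, Sum.forall, cover_inl, cover_inr]
      simp
  · rw [← ht, ← ht', ← ha, ← ha']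
    apply ncard_split
    · intro X Y
      simp only [Set.mem_ofPred_eq, Sum.forall, cover_inl, cover_inr]
      refine and_congr (forall_congr' fun v => ?_) (forall_congr' fun v => ?_) <;> tauto
    · intro X Y
      simp only [Set.mem_ofPred_eq, Sum.forall, cover_inl, cover_inr]
      simp

theorem exists_of_realized {t a : ℕ} (h : Realized t a) :
    ∃ (m : ℕ) (G : SimpleGraph (Fin m)), G.IsTree ∧ edgeCoverCount G = a := by
  obtain ⟨V, α, _, _, G, r, f, hG, hf, hfr, hc, -, ha⟩ := h
  obtain ⟨m, ⟨e⟩⟩ := Finite.exists_equiv_fin V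
  have hT : G.IsTree := by
    rw [isTree_iff_connected_and_card]
    refine ⟨hG, ?_⟩
    rw [← hc, ← hfr, Nat.card_range_of_injective hf]
  refine ⟨m, G.map e.toEmbedding, (Iso.map e G).isTree_iff.1 hT, ?_⟩
  rw [← ha, edgeCoverCount]
  have hinj : Function.Injective (fun i => (f i).map e) :=
    (Sym2.map.injective e.injective).comp hf
  have hE : (G.map e.toEmbedding).edgeSet = Set.range (fun i => (f i).map e) := by
    rw [edgeSet_map, ← hfr, ← Set.range_comp]
    rfl
  rw [← Set.ncard_image_of_injective _ hinj.image_injective]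
  congr 1
  ext E
  simp only [Set.mem_ofPred_eq, Set.mem_image]
  have hmem : ∀ (v : V) (i : α), e v ∈ (f i).map e ↔ v ∈ f i := by
    intro v i
    simp [Sym2.mem_map]
  constructor
  · rintro ⟨h1, h2⟩
    rw [hE] at h1
    obtain ⟨S, rfl⟩ := Set.subset_range_iff_exists_image_eq.1 h1
    refine ⟨S, ?_, rfl⟩
    intro v
    obtain ⟨_, ⟨i, hi, rfl⟩, hv⟩ := h2 (e v)
    exact ⟨i, hi, (hmem v i).1 hv⟩
  · rintro ⟨S, hS, rfl⟩
    refine ⟨by rw [hE]; exact Set.image_subset_range _ _, ?_⟩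
    intro w
    obtain ⟨v, rfl⟩ := e.surjective w
    obtain ⟨i, hi, hv⟩ := hS v
    exact ⟨_, ⟨i, hi, rfl⟩, (hmem v i).2 hv⟩

/-- Stack machine evaluating rooted trees written in (reversed) Polish notation as the binary
digits of a number: `0` pushes a leaf, `1` grafts the second entry on the first. -/
def runCode : ℕ → ℕ → List (ℕ × ℕ) → List (ℕ × ℕ)
  | 0, _, st => st
  | fuel + 1, c, st =>
    if c = 0 then st
    else if c % 2 = 0 then runCode fuel (c / 2) ((1, 0) :: st)
    else match st with
      | (t, a) :: (t', a') :: st => runCode fuel (c / 2) ((t * (t' + a'), t * t' + a * a') :: st)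
      | _ => []

theorem runCode_realized (fuel c : ℕ) (st : List (ℕ × ℕ)) (h : ∀ p ∈ st, Realized p.1 p.2) :
    ∀ p ∈ runCode fuel c st, Realized p.1 p.2 := by
  induction fuel generalizing c st with
  | zero => simpa [runCode] using h
  | succ fuel ih =>
    unfold runCode
    split_ifs
    · exact h
    · apply ih
      intro p hp
      rcases List.mem_cons.1 hp with rfl | hp
      · exact realized_leaf
      · exact h p hp
    · split
      · rename_i t a t' a' st
        apply ih
        intro p hp
        rcases List.mem_cons.1 hp with rfl | hp
        · exact realized_graft (h (t, a) (by simp)) (h (t', a') (by simp))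
        · exact h p (by simp [hp])
      · simp

/-- The code of a tree with `n` edge covers at position `n` (0 where none is recorded). -/
def codes : List ℕ :=
  [
   0, 4, 84, 340, 1380, 1364, 5476, 5540, 5460, 21908, 21860, 21924, 87652, 21844, 88484, 87444,
   87396, 87700, 87460, 0, 349796, 87380, 350820, 351524, 349588, 349780, 349540, 1402260,
   349844, 349604, 1399140, 1435940, 1398372, 1402276, 349524, 1399204, 1399396, 0, 1400100,
   1398164, 1398356, 0, 1398116, 1399444, 5613156, 1398420, 1399380, 1398180, 5593444, 5675428,
   5596516, 5609108, 5592676, 5624468, 5597588, 1398100, 5593508, 0, 5593700, 0, 5613988,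
   5594404, 5612964, 5592468, 5593428, 5592660, 22436452, 0, 5592420, 5593748, 22387108,
   5597780, 22373780, 5592724, 5593684, 22386068, 5592484, 22452644, 22370660, 0, 22373732,
   22497700, 0, 22453540, 22369892, 22386324, 22391140, 22374804, 22373796, 5592404, 22374756,
   22370724, 22390116, 22377620, 22370916, 22455716, 22401620, 0, 90610084, 22371620, 22390420,
   22451620, 22369684, 22374820, 22370644, 22369876, 89991524, 90083988, 89561444, 90827044,
   22369636, 0, 22370964, 91528484, 22374996, 89546020, 89499236, 22391380, 22369940, 22374740,
   22370900, 89810340, 89510500, 22369700, 89807460, 89516324, 89479524, 89814164, 89494884,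
   89564564, 89482596, 0, 358983268, 89608852, 89606564, 89499028, 89478756, 90791204, 89500004,
   89811364, 89544340, 89483668, 89564516, 89482660, 22369620, 89499220, 89483620, 89479588,
   89498980, 0, 358177124, 89486484, 89479780, 358979220, 89510484, 89564820, 357930596,
   89564580, 89560724, 89500068, 89480484, 89499284, 358245780, 89565604, 89499044, 89478548,
   89560484, 89483684, 89479508, 89482580, 89478740, 359262500, 358258276, 359963940, 357996900,
   358177188, 357980772, 0, 89478500, 0, 357996132, 89479828, 357931428, 89499988, 357981476,
   89483860, 362116244, 363173524, 106277460, 363240740, 362194340, 90854740, 362140244,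
   90875220, 90871124, 363439700, 366123668, 0, 362110244, 106255780, 362129044, 0, 426334820,
   425060644, 425023844, 0, 425106020, 425108884, 425039204, 427070884, 425026916, 425368868,
   425534884, 425153172, 425352484, 425150884, 426355108, 426354324, 1718216996, 425043348,
   425023076, 425039508, 425104788, 0, 425044324, 425104980, 430286244, 425413028, 425027988,
   425054868, 425286228, 425026980, 425088420, 106255700, 425039268, 425043540, 425027940, 0,
   425023908, 425368212, 425043300, 426334868, 425351828, 425367188, 425030804, 1701222820,
   425024100, 425150804, 425106068, 425109140, 425054804, 0, 425108900, 426333844, 425105044,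
   425371284, 425366948]

/-- The exceptional values. -/
def exceptional : List ℕ :=
  [0, 19, 37, 41, 57, 59, 67, 79, 82, 97, 111, 131, 149, 177, 179, 197, 201, 205, 223, 237, 251]

theorem codes_spec : ∀ n < 257, n ∈ exceptional ∨
    (runCode 40 (codes.getD n 0) []).head?.map Prod.snd = some n := by
  decide +kernel

/-- For every `1 ≤ n ≤ 256` outside the exceptional set
`{19, 37, 41, 57, 59, 67, 79, 82, 97, 111, 131, 149, 177, 179, 197, 201, 205, 223, 237,
251}`, there is a finite tree with exactly `n` edge covers. -/
theorem exists_tree_with_cover_count (n : ℕ) (h1 : 1 ≤ n) (h2 : n ≤ 256)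
    (h3 : n ∉ ({19, 37, 41, 57, 59, 67, 79, 82, 97, 111, 131, 149, 177, 179, 197, 201,
      205, 223, 237, 251} : Set ℕ)) :
    ∃ (m : ℕ) (G : SimpleGraph (Fin m)), G.IsTree ∧ edgeCoverCount G = n := by
  rcases codes_spec n (by omega) with h | h
  · exfalso
    simp only [exceptional, List.mem_cons, List.not_mem_nil, or_false] at h
    simp only [Set.mem_insert_iff, Set.mem_singleton_iff] at h3
    rcases h with h | h
    · omega
    · exact h3 h
  · obtain ⟨⟨t, a⟩, hp, hn⟩ := Option.map_eq_some_iff.1 h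
    have hr := runCode_realized 40 (codes.getD n 0) [] (by simp) (t, a) (List.mem_of_head? hp)
    obtain rfl : a = n := hn
    exact exists_of_realized hr
end
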